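/- Let U be an open neighborhood of the origin in ℝⁿ, let f belong to Ê(U), let Σ be a simplicial subdivision of the fan Σ₀ associated with Γ₊(f), and let σ be an n-dimensional cone of Σ with skeleton a¹(σ),…,aⁿ(σ) ∈ ℤ₊ⁿ; let π(σ) : ℝⁿ → ℝⁿ be the monomial map with k-th component x_k = ∏_{j=1}^n y_j^{a_k^j(σ)}. Then there exists a C^∞ function f_σ on π(σ)^{−1}(U) such that f_σ(0) ≠ 0 and (f∘π(σ))(y) = (∏_{j=1}^n y_j^{l(a^j(σ))}) f_σ(y) for all y ∈ π(σ)^{−1}(U). Furthermore, if f is nondegenerate over ℝ with respect to Γ₊(f) and I ⊂ {1,…,n} satisfies π(σ)(T_I^*(ℝⁿ)) = {0}, then the set {y ∈ T_I^*(ℝⁿ) : f_σ(y) = 0} is nonsingular: the gradient of the restriction of f_σ to T_I^*(ℝⁿ) does not vanish at any point of this set. -/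

import Mathlib

open scoped BigOperators Topology
open Filter MeasureTheory Set

namespace KN

variable {n : ℕ}

/-- The standard inner product on `ℝⁿ`. -/
def dot (a x : Fin n → ℝ) : ℝ := ∑ i, a i * x i

/-- The hyperplane `H(a,l) = {x | ⟨a,x⟩ = l}`. -/
def Hplane (a : Fin n → ℝ) (l : ℝ) : Set (Fin n → ℝ) := {x | dot a x = l}

/-- The closed half-space `H⁺(a,l) = {x | ⟨a,x⟩ ≥ l}`. -/
def Hhalf (a : Fin n → ℝ) (l : ℝ) : Set (Fin n → ℝ) := {x | l ≤ dot a x}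

/-- View an integer vector as a real vector. -/
def intPt (a : Fin n → ℤ) : Fin n → ℝ := fun i => (a i : ℝ)

/-- View a vector of naturals as a real vector. -/
def natPt (a : Fin n → ℕ) : Fin n → ℝ := fun i => (a i : ℝ)

/-- The nonnegative octant `ℝ₊ⁿ`. -/
def octant (n : ℕ) : Set (Fin n → ℝ) := {x | ∀ i, 0 ≤ x i}

/-- A (convex rational) polyhedron: a finite intersection of closed half-spaces with
integral data. -/
def IsPolyhedron (P : Set (Fin n → ℝ)) : Prop :=
  ∃ (N : ℕ) (a : Fin N → Fin n → ℤ) (l : Fin N → ℤ),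
    P = ⋂ j, Hhalf (intPt (a j)) ((l j : ℝ))

/-- `(a,l) ∈ ℤⁿ × ℤ` is valid for `P` if `P ⊆ H⁺(a,l)`. -/
def ValidPair (P : Set (Fin n → ℝ)) (a : Fin n → ℤ) (l : ℤ) : Prop :=
  P ⊆ Hhalf (intPt a) (l : ℝ)

/-- A face of a polyhedron `P`: a set of the form `P ∩ H(a,l)` with `(a,l)` valid for `P`. -/
def IsFaceOf (P F : Set (Fin n → ℝ)) : Prop :=
  ∃ (a : Fin n → ℤ) (l : ℤ), ValidPair P a l ∧ F = P ∩ Hplane (intPt a) (l : ℝ)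

/-- Dimension of a subset of `ℝⁿ`: the dimension of its affine hull. -/
noncomputable def setDim (s : Set (Fin n → ℝ)) : ℕ :=
  Module.finrank ℝ (affineSpan ℝ s).direction

/-- First-order partial derivative in the `i`-th coordinate direction. -/
noncomputable def pderiv1 (i : Fin n) (f : (Fin n → ℝ) → ℝ) : (Fin n → ℝ) → ℝ :=
  fun x => fderiv ℝ f x (Pi.single i 1)

/-- Iterated partial derivative `∂^α` for a multi-index `α ∈ ℤ₊ⁿ`. -/
noncomputable def mderiv (α : Fin n → ℕ) (f : (Fin n → ℝ) → ℝ) : (Fin n → ℝ) → ℝ :=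
  (List.finRange n).foldr (fun i g => (pderiv1 i)^[α i] g) f

/-- Taylor coefficient `c_α = ∂^α f(0)/α!`. -/
noncomputable def taylorCoeff (f : (Fin n → ℝ) → ℝ) (α : Fin n → ℕ) : ℝ :=
  mderiv α f 0 / ((∏ i, Nat.factorial (α i) : ℕ) : ℝ)

/-- The Newton polyhedron `Γ₊(f)`: the convex hull of `⋃ {α + ℝ₊ⁿ : c_α ≠ 0}`. -/
def NewtonPolyhedron (f : (Fin n → ℝ) → ℝ) : Set (Fin n → ℝ) :=
  convexHull ℝ {x | ∃ α : Fin n → ℕ, taylorCoeff f α ≠ 0 ∧ ∀ i, (α i : ℝ) ≤ x i}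

/-- The pair `(a,l) ∈ ℤ₊ⁿ × ℤ₊` is valid for `P` and defines the face `γ = P ∩ H(a,l)`. -/
def DefinesFace (P : Set (Fin n → ℝ)) (a : Fin n → ℕ) (l : ℕ) (γ : Set (Fin n → ℝ)) : Prop :=
  P ⊆ Hhalf (natPt a) (l : ℝ) ∧ γ = P ∩ Hplane (natPt a) (l : ℝ)

/-- The anisotropic dilation `x ↦ (t^{a₁}x₁, …, t^{aₙ}xₙ)`. -/
def scaleAction (a : Fin n → ℕ) (t : ℝ) (x : Fin n → ℝ) : Fin n → ℝ :=
  fun i => t ^ (a i) * x i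

/-- `f` admits the `γ`-part on `U` (w.r.t. the polyhedron `P`): for every `x ∈ U` the limit
`lim_{t→0⁺} f(t^{a₁}x₁,…,t^{aₙ}xₙ)/t^l` exists for all valid pairs `(a,l) ∈ ℤ₊ⁿ×ℤ₊`
defining `γ`. -/
def AdmitsGammaPartOn (f : (Fin n → ℝ) → ℝ) (U P γ : Set (Fin n → ℝ)) : Prop :=
  ∀ x ∈ U, ∀ (a : Fin n → ℕ) (l : ℕ), DefinesFace P a l γ →
    ∃ c : ℝ, Filter.Tendsto (fun t : ℝ => f (scaleAction a t x) / t ^ l) (𝓝[>] (0:ℝ)) (𝓝 c)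

/-- Membership in the class `Ê[P](U)`. -/
def MemEhatP (P U : Set (Fin n → ℝ)) (f : (Fin n → ℝ) → ℝ) : Prop :=
  ContDiffOn ℝ (⊤ : ℕ∞) f U ∧ NewtonPolyhedron f ⊆ P ∧
    ∀ γ, IsFaceOf P γ → AdmitsGammaPartOn f U P γ

/-- Membership in the class `Ê(U) = {f : f ∈ Ê[Γ₊(f)](U)}`, where `Ê[∅](U) = {0}`. -/
def MemEhat (U : Set (Fin n → ℝ)) (f : (Fin n → ℝ) → ℝ) : Prop :=
  (NewtonPolyhedron f = ∅ ∧ ∀ x ∈ U, f x = 0) ∨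
  (NewtonPolyhedron f ≠ ∅ ∧ MemEhatP (NewtonPolyhedron f) U f)

/-- The polynomial `γ`-part `Σ_{α ∈ γ ∩ ℤ₊ⁿ} c_α x^α`. -/
noncomputable def gammaPartPoly (f : (Fin n → ℝ) → ℝ) (γ : Set (Fin n → ℝ))
    (x : Fin n → ℝ) : ℝ :=
  ∑' α : {α : Fin n → ℕ // natPt α ∈ γ}, taylorCoeff f α.1 * ∏ i, x i ^ (α.1 i)

/-- `V(γ) = {k : γ + ℝ₊ e_k ⊆ γ}`. -/
def Vset (γ : Set (Fin n → ℝ)) : Set (Fin n) :=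
  {k | ∀ x ∈ γ, ∀ r : ℝ, 0 ≤ r → x + r • (Pi.single k (1:ℝ) : Fin n → ℝ) ∈ γ}

/-- `W(γ) = {1,…,n} \ V(γ)`. -/
def Wset (γ : Set (Fin n → ℝ)) : Set (Fin n) := (Vset γ)ᶜ

open Classical in
/-- `T_I` replaces the coordinates indexed by `I` with `0`. -/
noncomputable def TI (I : Set (Fin n)) (x : Fin n → ℝ) : Fin n → ℝ :=
  fun i => if i ∈ I then 0 else x i

open Classical in
/-- `T_I^r` replaces the coordinates indexed by `I` with `r`. -/
noncomputable def TIr (I : Set (Fin n)) (r : ℝ) (x : Fin n → ℝ) : Fin n → ℝ :=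
  fun i => if i ∈ I then r else x i

/-- The canonical `γ`-part function
`f_γ(x) = Σ_{α ∈ γ_V} (1/α!) (∂^α f)(T_{W(γ)}(x)) x^α`, with `γ_V = T_{V(γ)}(γ) ∩ ℤ₊ⁿ`. -/
noncomputable def gammaFn (f : (Fin n → ℝ) → ℝ) (γ : Set (Fin n → ℝ)) (x : Fin n → ℝ) : ℝ :=
  ∑' α : {α : Fin n → ℕ // natPt α ∈ TI (Vset γ) '' γ},
    mderiv α.1 f (TI (Wset γ) x) * (∏ i, x i ^ (α.1 i)) /
      ((∏ i, Nat.factorial (α.1 i) : ℕ) : ℝ)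

/-- `f` is nondegenerate over `ℝ` w.r.t. its Newton polyhedron: for every nonempty compact
face `γ` of `Γ₊(f)` the gradient of the polynomial `f_γ` does not vanish on
`U ∩ (ℝ \ {0})ⁿ`. -/
def Nondegenerate (f : (Fin n → ℝ) → ℝ) (U : Set (Fin n → ℝ)) : Prop :=
  ∀ γ, IsFaceOf (NewtonPolyhedron f) γ → γ.Nonempty → IsCompact γ →
    ∀ x ∈ U, (∀ i, x i ≠ 0) → fderiv ℝ (gammaPartPoly f γ) x ≠ 0

/-- Condition (C): `f ∈ Ê(U)` and `f` is nondegenerate over `ℝ` w.r.t. `Γ₊(f)`. -/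
def ConditionC (U : Set (Fin n → ℝ)) (f : (Fin n → ℝ) → ℝ) : Prop :=
  MemEhat U f ∧ Nondegenerate f U

/-- The Newton distance `d(f)`: the coordinate of the point where the diagonal meets
the boundary of `Γ₊(f)`. -/
noncomputable def newtonDist (f : (Fin n → ℝ) → ℝ) : ℝ :=
  sInf {t : ℝ | (fun _ : Fin n => t) ∈ NewtonPolyhedron f}

/-- `τ` is the principal face of `Γ₊(f)`: its relative interior contains
`q_* = (d(f),…,d(f))`. -/
def IsPrincipalFace (f : (Fin n → ℝ) → ℝ) (τ : Set (Fin n → ℝ)) : Prop :=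
  IsFaceOf (NewtonPolyhedron f) τ ∧
    (fun _ : Fin n => newtonDist f) ∈ intrinsicInterior ℝ τ

/-- The oscillatory integral `I(t;φ) = ∫ e^{itf(x)} φ(x) dx`. -/
noncomputable def oscInt (f : (Fin n → ℝ) → ℝ) (φ : (Fin n → ℝ) → ℂ) (t : ℝ) : ℂ :=
  ∫ x : Fin n → ℝ, Complex.exp (Complex.I * t * f x) * φ x

/-- `Z₊(s;φ) = ∫ f(x)₊^s φ(x) dx`. -/
noncomputable def zetaPlus (f : (Fin n → ℝ) → ℝ) (φ : (Fin n → ℝ) → ℂ) (s : ℂ) : ℂ :=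
  ∫ x : Fin n → ℝ, ((max (f x) 0 : ℝ) : ℂ) ^ s * φ x

/-- `Z₋(s;φ) = ∫ f(x)₋^s φ(x) dx`. -/
noncomputable def zetaMinus (f : (Fin n → ℝ) → ℝ) (φ : (Fin n → ℝ) → ℂ) (s : ℂ) : ℂ :=
  ∫ x : Fin n → ℝ, ((max (-f x) 0 : ℝ) : ℂ) ^ s * φ x

/-- The local zeta function `Z(s;φ) = ∫ |f(x)|^s φ(x) dx`. -/
noncomputable def zetaAbs (f : (Fin n → ℝ) → ℝ) (φ : (Fin n → ℝ) → ℂ) (s : ℂ) : ℂ :=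
  ∫ x : Fin n → ℝ, ((|f x| : ℝ) : ℂ) ^ s * φ x

/-- An amplitude: a `C^∞` function with compact support contained in `U ∩ V`. -/
def IsAmplitude (U V : Set (Fin n → ℝ)) (φ : (Fin n → ℝ) → ℂ) : Prop :=
  ContDiff ℝ (⊤ : ℕ∞) φ ∧ HasCompactSupport φ ∧ tsupport φ ⊆ U ∩ V

/-- Partial sum `Σ_{α ∈ E, α ≥ -M} Σ_{k=1}^n C_{αk} t^α (log t)^{k-1}`. -/
noncomputable def partialSum (n : ℕ) (E : Set ℝ) (C : ℝ → ℕ → ℂ) (M t : ℝ) : ℂ :=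
  ∑ᶠ α ∈ {β ∈ E | -M ≤ β}, ∑ k ∈ Finset.Icc 1 n,
    C α k * ((t ^ α : ℝ) : ℂ) * (((Real.log t) ^ (k - 1) : ℝ) : ℂ)

/-- `g(t)` admits the asymptotic expansion `Σ_{α ∈ E} Σ_{k=1}^n C_{αk} t^α (log t)^{k-1}`
as `t → +∞`. -/
def HasAsympExpansion (n : ℕ) (g : ℝ → ℂ) (E : Set ℝ) (C : ℝ → ℕ → ℂ) : Prop :=
  (∀ α k, C α k ≠ 0 → α ∈ E ∧ 1 ≤ k ∧ k ≤ n) ∧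
  ∀ M : ℝ, ∃ K : ℝ, ∀ t : ℝ, 2 ≤ t →
    ‖g t - partialSum n E C M t‖ ≤ K * t ^ (-M)

/-- A set of exponents consisting of negative numbers, finite above any `-M`. -/
def LocallyFiniteBelow (E : Set ℝ) : Prop :=
  E ⊆ Set.Iio 0 ∧ ∀ M : ℝ, {β ∈ E | -M ≤ β}.Finite

/-- The set `S(f)` of pairs `(α,k)` appearing with a nonzero coefficient in the asymptotic
expansion of `I(t;φ)` for amplitudes `φ` supported arbitrarily close to the origin. -/
def OscSet (U : Set (Fin n → ℝ)) (f : (Fin n → ℝ) → ℝ) : Set (ℝ × ℕ) :=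
  {p | ∀ V ∈ 𝓝 (0 : Fin n → ℝ), ∃ φ : (Fin n → ℝ) → ℂ, IsAmplitude U V φ ∧
      ∃ E C, LocallyFiniteBelow E ∧ HasAsympExpansion n (oscInt f φ) E C ∧ C p.1 p.2 ≠ 0}

/-- The cone spanned by the vectors `g j`, `j ∈ s`. -/
def coneSpanSub (g : Fin n → (Fin n → ℝ)) (s : Finset (Fin n)) : Set (Fin n → ℝ) :=
  {x | ∃ c : Fin n → ℝ, (∀ j, 0 ≤ c j) ∧ (∀ j ∉ s, c j = 0) ∧ x = ∑ j, c j • g j}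

/-- The cone spanned by all the vectors `g j`. -/
def coneSpan (g : Fin n → (Fin n → ℝ)) : Set (Fin n → ℝ) := coneSpanSub g Finset.univ

/-- `l(a) = min {⟨a,α⟩ : α ∈ Γ}`. -/
noncomputable def lval (Γ : Set (Fin n → ℝ)) (a : Fin n → ℝ) : ℝ := sInf (dot a '' Γ)

/-- Real matrix of skeleton vectors. -/
def genR (a : Fin n → (Fin n → ℕ)) : Fin n → (Fin n → ℝ) := fun j => natPt (a j)

/-- A simplicial subdivision `Σ` of the fan `Σ₀` associated with `Γ`, presented via the
skeletons of its `n`-dimensional cones: each maximal cone is unimodular (its skeleton can be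
completed to a basis of the lattice `ℤⁿ`), the cones cover `ℝ₊ⁿ`, each cone lies in a cone
`closure(γ*)` of the fan `Σ₀`, and two cones intersect in a common face. -/
structure SimplicialSubdivision (n : ℕ) (Γ : Set (Fin n → ℝ)) where
  ι : Type
  fin : Fintype ι
  gen : ι → Fin n → (Fin n → ℕ)
  unimodular : ∀ σ, (Matrix.det (Matrix.of fun j k => (gen σ j k : ℤ))).natAbs = 1
  covers : ∀ x ∈ octant n, ∃ σ, x ∈ coneSpan (genR (gen σ))
  subordinate : ∀ σ, ∃ γ, IsFaceOf Γ γ ∧ γ.Nonempty ∧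
      ∀ j, ∀ y ∈ γ, dot (natPt (gen σ j)) y = lval Γ (natPt (gen σ j))
  compatible : ∀ σ τ, ∃ s : Finset (Fin n),
      (∀ j ∈ s, gen σ j ∈ Set.range (gen τ)) ∧
      coneSpan (genR (gen σ)) ∩ coneSpan (genR (gen τ)) = coneSpanSub (genR (gen σ)) s

/-- The set `Σ^{(1)}` of primitive generators of the one-dimensional cones of `Σ`. -/
def sigma1 {n : ℕ} {Γ : Set (Fin n → ℝ)} (S : SimplicialSubdivision n Γ) :
    Set (Fin n → ℕ) :=
  {a | ∃ σ j, S.gen σ j = a}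

/-- The set `{-(⟨a⟩+ν)/l(a) : ν ∈ ℤ₊, a ∈ Σ̃^{(1)}}`. -/
noncomputable def expSetMain {n : ℕ} (Γ : Set (Fin n → ℝ))
    (S : SimplicialSubdivision n Γ) : Set ℝ :=
  {r | ∃ a ∈ sigma1 S, 0 < lval Γ (natPt a) ∧
        ∃ ν : ℕ, r = -((∑ i, (a i : ℝ)) + (ν : ℝ)) / lval Γ (natPt a)}

/-- The full candidate set `{-(⟨a⟩+ν)/l(a)} ∪ (-ℕ)`. -/
noncomputable def expSet {n : ℕ} (Γ : Set (Fin n → ℝ))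
    (S : SimplicialSubdivision n Γ) : Set ℝ :=
  expSetMain Γ S ∪ {r | ∃ m : ℕ, r = -((m : ℝ) + 1)}

/-- `G` has at `s₀` a pole of order at most `m` (in particular `G` may be analytic there). -/
def PoleOrderAtMost (G : ℂ → ℂ) (s₀ : ℂ) (m : ℕ) : Prop :=
  ∃ h : ℂ → ℂ, AnalyticAt ℂ h s₀ ∧ ∀ᶠ s in 𝓝[≠] s₀, (s - s₀) ^ m * G s = h s


open Classical in
/-- `A_V(N) = {α ∈ T_V(ℤ₊ⁿ) : ⟨α⟩ < N}`. -/
noncomputable def ASetF (n : ℕ) (V : Finset (Fin n)) (N : ℕ) : Finset (Fin n → ℕ) :=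
  (Fintype.piFinset fun _ : Fin n => Finset.range (N + 1)).filter
    (fun α => (∀ j ∈ V, α j = 0) ∧ ∑ i, α i < N)

open Classical in
/-- `B_V(N) = {α ∈ T_V(ℤ₊ⁿ) : ⟨α⟩ = N}`. -/
noncomputable def BSetF (n : ℕ) (V : Finset (Fin n)) (N : ℕ) : Finset (Fin n → ℕ) :=
  (Fintype.piFinset fun _ : Fin n => Finset.range (N + 1)).filter
    (fun α => (∀ j ∈ V, α j = 0) ∧ ∑ i, α i = N)

/-- `v` is a vertex (0-dimensional face) of `P`. -/
def IsVertex (P : Set (Fin n → ℝ)) (v : Fin n → ℝ) : Prop := IsFaceOf P {v}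

/-- Membership in the class `Ě[P](U)`: an element of `Ê[P](U)` expressible as
`Σ_{p∈S} x^p ψ_p(x)` with `S ⊆ P ∩ ℤ₊ⁿ` finite containing all vertices of `P`, and
`ψ_p(0) ≠ 0` for each vertex `p`. -/
def MemEcheck (P U : Set (Fin n → ℝ)) (f : (Fin n → ℝ) → ℝ) : Prop :=
  MemEhatP P U f ∧
  ∃ S : Finset (Fin n → ℕ), (∀ p ∈ S, natPt p ∈ P) ∧
    (∀ v, IsVertex P v → ∃ p ∈ S, natPt p = v) ∧
    ∃ ψ : (Fin n → ℕ) → (Fin n → ℝ) → ℝ,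
      (∀ p ∈ S, ContDiffOn ℝ (⊤ : ℕ∞) (ψ p) U) ∧
      (∀ p ∈ S, IsVertex P (natPt p) → ψ p 0 ≠ 0) ∧
      ∀ x ∈ U, f x = ∑ p ∈ S, (∏ i, x i ^ p i) * ψ p x

/-- Membership in the class `Ẽ(U)`: functions of the form `Σ_{p∈S} x^p ψ_p(x)` with
`ψ_p(0) ≠ 0` for all `p ∈ S`. -/
def MemEtilde (U : Set (Fin n → ℝ)) (f : (Fin n → ℝ) → ℝ) : Prop :=
  ∃ S : Finset (Fin n → ℕ), ∃ ψ : (Fin n → ℕ) → (Fin n → ℝ) → ℝ,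
    (∀ p ∈ S, ContDiffOn ℝ (⊤ : ℕ∞) (ψ p) U) ∧ (∀ p ∈ S, ψ p 0 ≠ 0) ∧
    ∀ x ∈ U, f x = ∑ p ∈ S, (∏ i, x i ^ p i) * ψ p x

/-- Membership in the Denjoy–Carleman class `ℰ_M(U)`. -/
def MemDC (M : ℕ → ℝ) (U : Set (Fin n → ℝ)) (f : (Fin n → ℝ) → ℝ) : Prop :=
  ContDiffOn ℝ (⊤ : ℕ∞) f U ∧
  ∀ K : Set (Fin n → ℝ), K ⊆ U → IsCompact K →
    ∃ A B : ℝ, 0 < A ∧ 0 < B ∧ ∀ x ∈ K, ∀ α : Fin n → ℕ,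
      |mderiv α f x| ≤ A * B ^ (∑ i, α i) * ((∏ i, Nat.factorial (α i) : ℕ) : ℝ) *
        M (∑ i, α i)

open Classical in
/-- The multi-index `α - 1` from the proof of Proposition 9.5:
`(α-1)_j = l_jλ - m_j` for `j ∈ B_λ`, `(α-1)_n = λ - 1`, and `0` otherwise. -/
noncomputable def alphaIdx (n lam : ℕ) (l m : Fin n → ℕ) (Bl : Finset (Fin n)) :
    Fin (n+1) → ℕ :=
  fun i => if h : i = Fin.last n then lam - 1
    else if i.castPred h ∈ Bl then l (i.castPred h) * lam - m (i.castPred h) else 0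

open Classical in
/-- The constant `C_λ` of Proposition 9.5. -/
noncomputable def Cval (n lam : ℕ) (l m : Fin n → ℕ) (Bl : Finset (Fin n))
    (η : (Fin (n+1) → ℝ) → ℝ) : ℝ :=
  (1 / (Nat.factorial (lam - 1) : ℝ)) *
  (∏ j ∈ Bl, ((l j : ℝ) *
      ∏ ν ∈ Finset.Icc 1 (l j * lam - m j),
        (((l j * lam : ℕ) : ℝ) - (m j : ℝ) + 1 - (ν : ℝ)))⁻¹) *
  (if Bl = Finset.univ then mderiv (alphaIdx n lam l m Bl) η 0
   else ∫ z : {j : Fin n // j ∉ Bl} → ℝ in {z | ∀ j, 0 ≤ z j},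
     mderiv (alphaIdx n lam l m Bl) η
       (fun i => if h : i = Fin.last n then 0
         else if hj : i.castPred h ∈ Bl then 0 else z ⟨i.castPred h, hj⟩))


section ParametricIntegral

variable {E : Type} [NormedAddCommGroup E] [NormedSpace ℝ E] [FiniteDimensional ℝ E]

theorem hasFDerivAt_parametric_integral {G : Type} [NormedAddCommGroup G] [NormedSpace ℝ G]
    {F : E → ℝ → G} (hF : ContDiff ℝ 1 (Function.uncurry F)) (x₀ : E) :
    HasFDerivAt (fun x => ∫ t in (0:ℝ)..1, F x t)
      (∫ t in (0:ℝ)..1, (fderiv ℝ (Function.uncurry F) (x₀, t)).comp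
        (ContinuousLinearMap.inl ℝ E ℝ)) x₀ := by
  set F' : E → ℝ → E →L[ℝ] G := fun x t => (fderiv ℝ (Function.uncurry F) (x, t)).comp
        (ContinuousLinearMap.inl ℝ E ℝ) with hF'
  have hcont : Continuous (Function.uncurry F') := by
    have := hF.continuous_fderiv one_ne_zero
    exact this.clm_comp continuous_const
  have hK : IsCompact (Metric.closedBall x₀ 1 ×ˢ Set.Icc (0:ℝ) 1) :=
    (isCompact_closedBall x₀ 1).prod isCompact_Icc
  obtain ⟨C, hC⟩ := hK.exists_bound_of_continuousOn hcont.continuousOn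
  refine intervalIntegral.hasFDerivAt_integral_of_dominated_of_fderiv_le
    (F := F) (F' := F') (bound := fun _ => C) (Metric.closedBall_mem_nhds x₀ one_pos) ?_ ?_ ?_ ?_ ?_ ?_
  · refine Eventually.of_forall fun x => ?_
    exact (hF.continuous.comp (by fun_prop : Continuous fun t : ℝ => (x, t))).aestronglyMeasurable
  · exact (hF.continuous.comp (by fun_prop : Continuous fun t : ℝ => (x₀, t))).intervalIntegrable _ _
  · exact (hcont.comp (by fun_prop : Continuous fun t : ℝ => (x₀, t))).aestronglyMeasurable
  · refine Eventually.of_forall fun t ht x hx => ?_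
    rw [Set.uIoc_of_le zero_le_one] at ht
    exact hC (x, t) ⟨hx, ht.1.le, ht.2⟩
  · exact intervalIntegrable_const
  · refine Eventually.of_forall fun t _ x _ => ?_
    have h1 : HasFDerivAt (Function.uncurry F) (fderiv ℝ (Function.uncurry F) (x, t)) (x, t) :=
      (hF.differentiable one_ne_zero _).hasFDerivAt
    have h2 : HasFDerivAt (fun x : E => (x, t)) (ContinuousLinearMap.inl ℝ E ℝ) x :=
      hasFDerivAt_prodMk_left x t
    exact h1.comp x h2

theorem contDiff_parametric_integral_nat (k : ℕ) :
    ∀ {G : Type} [NormedAddCommGroup G] [NormedSpace ℝ G] {F : E → ℝ → G},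
      ContDiff ℝ (⊤ : ℕ∞) (Function.uncurry F) →
      ContDiff ℝ k (fun x => ∫ t in (0:ℝ)..1, F x t) := by
  induction k with
  | zero =>
    intro G _ _ F hF
    refine contDiff_zero.2 ?_
    exact (Differentiable.continuous fun x =>
      (hasFDerivAt_parametric_integral (hF.of_le (by exact_mod_cast le_top)) x).differentiableAt)
  | succ k ih =>
    intro G _ _ F hF
    refine contDiff_succ_iff_hasFDerivAt.2 ⟨_, ?_, fun x =>
      hasFDerivAt_parametric_integral (hF.of_le (by exact_mod_cast le_top)) x⟩
    refine ih ?_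
    exact (hF.fderiv_right (m := (⊤ : ℕ∞)) (by simp)).clm_comp contDiff_const

theorem contDiff_parametric_integral {G : Type} [NormedAddCommGroup G] [NormedSpace ℝ G]
    {F : E → ℝ → G} (hF : ContDiff ℝ (⊤ : ℕ∞) (Function.uncurry F)) :
    ContDiff ℝ (⊤ : ℕ∞) (fun x => ∫ t in (0:ℝ)..1, F x t) :=
  contDiff_infty.2 fun k => contDiff_parametric_integral_nat k hF

end ParametricIntegral

/-- A function that is smooth near a point agrees near that point with a globally smooth one. -/
theorem exists_contDiff_eventuallyEq {V : Set (Fin n → ℝ)} (hV : IsOpen V)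
    {g : (Fin n → ℝ) → ℝ} (hg : ContDiffOn ℝ (⊤ : ℕ∞) g V) {y₀ : Fin n → ℝ} (hy₀ : y₀ ∈ V) :
    ∃ G : (Fin n → ℝ) → ℝ, ContDiff ℝ (⊤ : ℕ∞) G ∧ G =ᶠ[𝓝 y₀] g := by
  obtain ⟨r, hr, hrV⟩ := Metric.isOpen_iff.1 hV y₀ hy₀
  let χ : ContDiffBump y₀ := ⟨r / 4, r / 2, by positivity, by linarith⟩
  refine ⟨fun y => χ y * g y, ?_, ?_⟩
  · refine contDiff_iff_contDiffAt.2 fun y => ?_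
    by_cases hy : y ∈ V
    · exact χ.contDiffAt.mul (hg.contDiffAt (hV.mem_nhds hy))
    · have hyc : y ∈ (Metric.closedBall y₀ (r / 2))ᶜ := fun h =>
        hy (hrV (Metric.closedBall_subset_ball (by linarith) h))
      refine (contDiffAt_const (c := (0:ℝ))).congr_of_eventuallyEq ?_
      filter_upwards [Metric.isClosed_closedBall.isOpen_compl.mem_nhds hyc] with z hz
      have : χ z = 0 := χ.zero_of_le_dist (by
        have : r / 2 < dist z y₀ := by simpa using hz
        exact this.le)
      simp [this]
  · filter_upwards [χ.eventuallyEq_one] with y hy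
    simp [hy]

theorem contDiff_update_mul (j : Fin n) :
    ContDiff ℝ (⊤ : ℕ∞)
      (fun p : (Fin n → ℝ) × ℝ => Function.update p.1 j (p.2 * p.1 j)) := by
  refine contDiff_pi.2 fun i => ?_
  by_cases h : i = j
  · subst h
    simp only [Function.update_self]
    fun_prop
  · simp only [Function.update_of_ne h]
    fun_prop

theorem hasDerivAt_update_mul (y : Fin n → ℝ) (j : Fin n) (t : ℝ) :
    HasDerivAt (fun t : ℝ => Function.update y j (t * y j))
      (y j • (Pi.single j (1:ℝ) : Fin n → ℝ)) t := by
  refine hasDerivAt_pi.2 fun i => ?_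
  by_cases h : i = j
  · subst h
    simpa using (hasDerivAt_id t).mul_const (y i)
  · simpa [Function.update_of_ne h, Pi.single_eq_of_ne h] using hasDerivAt_const t (y i)

theorem sub_update_eq_mul_integral {G : (Fin n → ℝ) → ℝ} (hG : ContDiff ℝ (⊤ : ℕ∞) G)
    (j : Fin n) (y : Fin n → ℝ) :
    G y - G (Function.update y j 0) =
      y j * ∫ t in (0:ℝ)..1, fderiv ℝ G (Function.update y j (t * y j)) (Pi.single j 1) := by
  have hd : ∀ t : ℝ, HasDerivAt (fun t : ℝ => G (Function.update y j (t * y j)))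
      (y j * fderiv ℝ G (Function.update y j (t * y j)) (Pi.single j 1)) t := fun t => by
    have h1 := ((hG.differentiable (by simp)) (Function.update y j (t * y j))).hasFDerivAt
    have := h1.comp_hasDerivAt t (hasDerivAt_update_mul y j t)
    rw [map_smul, smul_eq_mul] at this
    exact this
  have hc : Continuous fun t : ℝ =>
      fderiv ℝ G (Function.update y j (t * y j)) (Pi.single j 1) := by
    have h1 : Continuous (fderiv ℝ G) := hG.continuous_fderiv (by simp)
    have h2 : Continuous fun t : ℝ => Function.update y j (t * y j) :=
      (contDiff_update_mul j).continuous.comp (by fun_prop : Continuous fun t : ℝ => (y, t))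
    exact (h1.comp h2).clm_apply continuous_const
  have := intervalIntegral.integral_eq_sub_of_hasDerivAt (a := 0) (b := 1)
    (fun t _ => hd t) ((continuous_const.mul hc).intervalIntegrable _ _)
  rw [intervalIntegral.integral_const_mul] at this
  simpa using this.symm

/-- Hadamard's lemma: a smooth function vanishing on the hyperplane `y_j = 0` is divisible
by `y_j`. -/
theorem exists_eq_coord_mul {V : Set (Fin n → ℝ)} (hV : IsOpen V)
    {g : (Fin n → ℝ) → ℝ} (hg : ContDiffOn ℝ (⊤ : ℕ∞) g V) (j : Fin n)
    (h0 : ∀ y ∈ V, y j = 0 → g y = 0) :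
    ∃ h : (Fin n → ℝ) → ℝ, ContDiffOn ℝ (⊤ : ℕ∞) h V ∧ ∀ y ∈ V, g y = y j * h y := by
  classical
  refine ⟨fun y => if y j = 0 then fderiv ℝ g y (Pi.single j 1) else g y / y j, ?_, ?_⟩
  · intro y₀ hy₀
    refine ContDiffAt.contDiffWithinAt ?_
    by_cases hj : y₀ j = 0
    · obtain ⟨G, hG, hGg⟩ := exists_contDiff_eventuallyEq hV hg hy₀
      have hH : ContDiff ℝ (⊤ : ℕ∞) (fun y : Fin n → ℝ => ∫ t in (0:ℝ)..1,
          fderiv ℝ G (Function.update y j (t * y j)) (Pi.single j 1)) := by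
        refine contDiff_parametric_integral (F := fun y t =>
          fderiv ℝ G (Function.update y j (t * y j)) (Pi.single j 1)) ?_
        have h1 : ContDiff ℝ (⊤ : ℕ∞) (fderiv ℝ G) := hG.fderiv_right (by simp)
        exact (h1.comp (contDiff_update_mul j)).clm_apply contDiff_const
      refine hH.contDiffAt.congr_of_eventuallyEq ?_
      have htend : Tendsto (fun y : Fin n → ℝ => Function.update y j 0) (𝓝 y₀) (𝓝 y₀) := by
        have hc : Continuous fun y : Fin n → ℝ => Function.update y j (0:ℝ) :=
          continuous_id.update j continuous_const
        have hu : Function.update y₀ j (0:ℝ) = y₀ := by rw [← hj, Function.update_eq_self]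
        simpa only [hu] using hc.tendsto y₀
      filter_upwards [hGg, hGg.eventuallyEq_nhds, htend.eventually hGg, hV.mem_nhds hy₀,
        htend.eventually (hV.mem_nhds hy₀)] with y hy hy' hyu hyV hyuV
      split_ifs with hyj
      · rw [← hy'.fderiv_eq]
        have : ∀ t : ℝ, Function.update y j (t * y j) = y := fun t => by
          rw [hyj, mul_zero, ← hyj, Function.update_eq_self]
        simp [this]
      · have := sub_update_eq_mul_integral hG j y
        rw [hyu, h0 _ hyuV (by simp), sub_zero, hy] at this
        rw [this, mul_div_cancel_left₀ _ hyj]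
    · refine ((hg.contDiffAt (hV.mem_nhds hy₀)).div (g := fun y => y j) (by fun_prop) hj).congr_of_eventuallyEq ?_
      have : ∀ᶠ y in 𝓝 y₀, y j ≠ 0 := (continuous_apply j).continuousAt.eventually_ne hj
      filter_upwards [this] with y hy
      simp [hy]
  · intro y hy
    dsimp only
    split_ifs with hyj
    · rw [h0 y hy hyj, hyj, zero_mul]
    · field_simp

theorem tendsto_update_nhdsGT (y : Fin n → ℝ) {j : Fin n} (hj : y j = 0) :
    Tendsto (fun s : ℝ => Function.update y j s) (𝓝[>] 0) (𝓝 y) := by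
  have hc : Continuous fun s : ℝ => Function.update y j s :=
    continuous_const.update j continuous_id
  have hu : Function.update y j (0:ℝ) = y := by rw [← hj, Function.update_eq_self]
  simpa only [hu] using (hc.tendsto 0).mono_left nhdsWithin_le_nhds

/-- A function continuous on an open set that vanishes at the points of the hyperplane `y_j = 0`
whose other coordinates are nonzero vanishes on the whole hyperplane. -/
theorem eq_zero_of_generic {V : Set (Fin n → ℝ)} (hV : IsOpen V)
    {g : (Fin n → ℝ) → ℝ} (hg : ContinuousOn g V) (j : Fin n)
    (h : ∀ y ∈ V, y j = 0 → (∀ i ≠ j, y i ≠ 0) → g y = 0) :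
    ∀ y ∈ V, y j = 0 → g y = 0 := by
  intro y hy hyj
  let p : ℝ → Fin n → ℝ := fun s => Function.update (fun i => y i + s) j 0
  have hpc : Continuous p :=
    (continuous_pi fun i => continuous_const.add continuous_id).update j continuous_const
  have hp0 : p 0 = y := by
    simp only [p, add_zero]
    rw [← hyj, Function.update_eq_self]
  have hp : Tendsto p (𝓝[>] 0) (𝓝 y) := by
    simpa only [hp0] using (hpc.tendsto 0).mono_left nhdsWithin_le_nhds
  have h1 : Tendsto (fun s => g (p s)) (𝓝[>] 0) (𝓝 (g y)) :=
    (hg.continuousAt (hV.mem_nhds hy)).tendsto.comp hp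
  have hne : ∀ᶠ s in 𝓝[>] (0:ℝ), ∀ i, y i + s ≠ 0 := by
    refine eventually_all.2 fun i => ?_
    by_cases hi : y i = 0
    · filter_upwards [self_mem_nhdsWithin] with s hs
      simpa [hi] using (ne_of_gt hs)
    · have : ContinuousAt (fun s : ℝ => y i + s) 0 := by fun_prop
      exact (this.eventually_ne (by simpa using hi)).filter_mono nhdsWithin_le_nhds
  have h2 : (fun s => g (p s)) =ᶠ[𝓝[>] 0] fun _ => 0 := by
    filter_upwards [hne, hp.eventually (hV.mem_nhds hy)] with s hs hsV
    refine h _ hsV (by simp [p]) fun i hi => ?_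
    simpa [p, Function.update_of_ne hi] using hs i
  exact tendsto_nhds_unique h1 (tendsto_const_nhds.congr' h2.symm)

/-- A smooth function whose growth transverse to each coordinate hyperplane is bounded by a power
of the coordinate is divisible by the product of these powers. -/
theorem exists_eq_monomial_mul {V : Set (Fin n → ℝ)} (hV : IsOpen V) (N : ℕ) :
    ∀ (L : Fin n → ℕ), ∑ i, L i = N → ∀ g : (Fin n → ℝ) → ℝ, ContDiffOn ℝ (⊤ : ℕ∞) g V →
    (∀ j, ∀ y ∈ V, y j = 0 → (∀ i ≠ j, y i ≠ 0) →
      ∃ c, Tendsto (fun s : ℝ => g (Function.update y j s) / s ^ L j) (𝓝[>] 0) (𝓝 c)) →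
    ∃ h : (Fin n → ℝ) → ℝ, ContDiffOn ℝ (⊤ : ℕ∞) h V ∧
      ∀ y ∈ V, g y = (∏ i, y i ^ L i) * h y := by
  induction N with
  | zero =>
    intro L hL g hg _
    have : ∀ i, L i = 0 := by simpa using hL
    exact ⟨g, hg, fun y _ => by simp [this]⟩
  | succ N ih =>
    intro L hL g hg hlim
    obtain ⟨j, hj⟩ : ∃ j, L j ≠ 0 := by
      by_contra! hcon
      simp [hcon] at hL
    obtain ⟨m, hm⟩ := Nat.exists_eq_succ_of_ne_zero hj
    have hvan : ∀ y ∈ V, y j = 0 → g y = 0 := by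
      refine eq_zero_of_generic hV hg.continuousOn j fun y hy hyj hyi => ?_
      obtain ⟨c, hc⟩ := hlim j y hy hyj hyi
      have h1 : Tendsto (fun s => g (Function.update y j s)) (𝓝[>] 0) (𝓝 (g y)) :=
        (hg.continuousOn.continuousAt (hV.mem_nhds hy)).tendsto.comp (tendsto_update_nhdsGT y hyj)
      have h2 : Tendsto (fun s : ℝ => s ^ L j) (𝓝[>] 0) (𝓝 0) := by
        have : Continuous fun s : ℝ => s ^ L j := by fun_prop
        simpa [hj] using (this.tendsto 0).mono_left (nhdsWithin_le_nhds (s := Set.Ioi 0))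
      have h3 := hc.mul h2
      rw [mul_zero] at h3
      refine tendsto_nhds_unique h1 (h3.congr' ?_)
      filter_upwards [self_mem_nhdsWithin] with s hs
      exact div_mul_cancel₀ _ (pow_ne_zero _ (ne_of_gt hs))
    obtain ⟨h, hh, hgh⟩ := exists_eq_coord_mul hV hg j hvan
    have hprod : ∀ y : Fin n → ℝ,
        ∏ i, y i ^ L i = y j * ∏ i, y i ^ (Function.update L j m) i := fun y => by
      rw [← Finset.mul_prod_erase _ _ (Finset.mem_univ j),
        ← Finset.mul_prod_erase _ (fun i => y i ^ (Function.update L j m) i) (Finset.mem_univ j),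
        Function.update_self, hm, pow_succ', mul_assoc]
      congr 2
      refine Finset.prod_congr rfl fun i hi => ?_
      rw [Function.update_of_ne (Finset.ne_of_mem_erase hi)]
    have hsum : ∑ i, Function.update L j m i = N := by
      have h1 := Finset.add_sum_erase Finset.univ L (Finset.mem_univ j)
      have h2 := Finset.add_sum_erase Finset.univ (Function.update L j m) (Finset.mem_univ j)
      have h3 : ∑ i ∈ Finset.univ.erase j, Function.update L j m i =
          ∑ i ∈ Finset.univ.erase j, L i :=
        Finset.sum_congr rfl fun i hi => by
          rw [Function.update_of_ne (Finset.ne_of_mem_erase hi)]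
      rw [Function.update_self] at h2
      omega
    obtain ⟨k, hk, hhk⟩ := ih (Function.update L j m) hsum h hh fun i y hy hyi hne => by
      obtain ⟨c, hc⟩ := hlim i y hy hyi hne
      have hmem : ∀ᶠ s in 𝓝[>] (0:ℝ), Function.update y i s ∈ V :=
        (tendsto_update_nhdsGT y hyi).eventually (hV.mem_nhds hy)
      by_cases hij : i = j
      · subst hij
        refine ⟨c, hc.congr' ?_⟩
        filter_upwards [self_mem_nhdsWithin, hmem] with s hs hsV
        have hs' : s ≠ 0 := ne_of_gt hs
        rw [hgh _ hsV, Function.update_self, Function.update_self, hm, pow_succ',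
          mul_div_mul_left _ _ hs']
      · refine ⟨c / y j, (hc.div_const (y j)).congr' ?_⟩
        filter_upwards [hmem] with s hsV
        have hyj : y j ≠ 0 := hne j (Ne.symm hij)
        rw [hgh _ hsV, Function.update_of_ne (Ne.symm hij), Function.update_of_ne hij]
        field_simp
    exact ⟨k, hk, fun y hy => by rw [hgh y hy, hhk y hy, hprod y, mul_assoc]⟩

section PartialDerivatives

theorem contDiff_pderiv1 {G : (Fin n → ℝ) → ℝ} (hG : ContDiff ℝ (⊤ : ℕ∞) G) (i : Fin n) :
    ContDiff ℝ (⊤ : ℕ∞) (pderiv1 i G) :=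
  (hG.fderiv_right (m := (⊤ : ℕ∞)) (by simp)).clm_apply contDiff_const

theorem pderiv1_comm {G : (Fin n → ℝ) → ℝ} (hG : ContDiff ℝ (⊤ : ℕ∞) G) (i j : Fin n) :
    pderiv1 i (pderiv1 j G) = pderiv1 j (pderiv1 i G) := by
  have hd : ContDiff ℝ (⊤ : ℕ∞) (fderiv ℝ G) := hG.fderiv_right (by simp)
  have key : ∀ (i j : Fin n) (x : Fin n → ℝ), pderiv1 i (pderiv1 j G) x =
      fderiv ℝ (fderiv ℝ G) x (Pi.single i 1) (Pi.single j 1) := fun i j x => by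
    have h1 := (hd.differentiable (by simp) x).hasFDerivAt
    have h2 := h1.clm_apply (hasFDerivAt_const (Pi.single j (1:ℝ) : Fin n → ℝ) x)
    have h3 : fderiv ℝ (pderiv1 j G) x = _ := h2.fderiv
    rw [pderiv1, h3]
    simp
  funext x
  rw [key, key]
  have hs : IsSymmSndFDerivAt ℝ G x :=
    hG.contDiffAt.isSymmSndFDerivAt (by
      rw [minSmoothness_of_isRCLikeNormedField]; exact WithTop.coe_le_coe.2 (le_top : (2 : ℕ∞) ≤ ⊤))
  exact hs.eq _ _

theorem contDiff_iterate_pderiv1 {G : (Fin n → ℝ) → ℝ} (hG : ContDiff ℝ (⊤ : ℕ∞) G)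
    (i : Fin n) (k : ℕ) : ContDiff ℝ (⊤ : ℕ∞) ((pderiv1 i)^[k] G) := by
  induction k with
  | zero => exact hG
  | succ k ih =>
    rw [Function.iterate_succ_apply']
    exact contDiff_pderiv1 ih i

theorem iterate_pderiv1_comm {G : (Fin n → ℝ) → ℝ} (hG : ContDiff ℝ (⊤ : ℕ∞) G)
    (i j : Fin n) (k : ℕ) :
    (pderiv1 i)^[k] (pderiv1 j G) = pderiv1 j ((pderiv1 i)^[k] G) := by
  induction k with
  | zero => rfl
  | succ k ih =>
    rw [Function.iterate_succ_apply', Function.iterate_succ_apply', ih,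
      pderiv1_comm (contDiff_iterate_pderiv1 hG i k)]

/-- The partial derivatives along the coordinates in the list `s`. -/
noncomputable def mderivList (s : List (Fin n)) (α : Fin n → ℕ) (f : (Fin n → ℝ) → ℝ) :
    (Fin n → ℝ) → ℝ :=
  s.foldr (fun i g => (pderiv1 i)^[α i] g) f

theorem mderivList_cons (i : Fin n) (s : List (Fin n)) (α : Fin n → ℕ)
    (f : (Fin n → ℝ) → ℝ) :
    mderivList (i :: s) α f = (pderiv1 i)^[α i] (mderivList s α f) := rfl

theorem contDiff_mderivList {G : (Fin n → ℝ) → ℝ} (hG : ContDiff ℝ (⊤ : ℕ∞) G)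
    (s : List (Fin n)) (α : Fin n → ℕ) : ContDiff ℝ (⊤ : ℕ∞) (mderivList s α G) := by
  induction s with
  | nil => exact hG
  | cons i s ih => exact contDiff_iterate_pderiv1 ih i _

theorem mderivList_pderiv1 {G : (Fin n → ℝ) → ℝ} (hG : ContDiff ℝ (⊤ : ℕ∞) G)
    (s : List (Fin n)) (α : Fin n → ℕ) (j : Fin n) :
    mderivList s α (pderiv1 j G) = pderiv1 j (mderivList s α G) := by
  induction s with
  | nil => rfl
  | cons i s ih =>
    rw [mderivList_cons, mderivList_cons, ih, iterate_pderiv1_comm (contDiff_mderivList hG s α)]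

theorem mderivList_add_single_of_notMem (G : (Fin n → ℝ) → ℝ)
    {s : List (Fin n)} (α : Fin n → ℕ) {j : Fin n} (hj : j ∉ s) :
    mderivList s (α + Pi.single j 1) G = mderivList s α G := by
  induction s with
  | nil => rfl
  | cons i s ih =>
    rw [List.mem_cons, not_or] at hj
    rw [mderivList_cons, mderivList_cons, ih hj.2, Pi.add_apply,
      Pi.single_eq_of_ne (Ne.symm hj.1), add_zero]

theorem mderivList_add_single {G : (Fin n → ℝ) → ℝ} (hG : ContDiff ℝ (⊤ : ℕ∞) G)
    {s : List (Fin n)} (hs : s.Nodup) (α : Fin n → ℕ) {j : Fin n} (hj : j ∈ s) :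
    mderivList s (α + Pi.single j 1) G = pderiv1 j (mderivList s α G) := by
  induction s with
  | nil => simp at hj
  | cons i s ih =>
    rw [List.nodup_cons] at hs
    rw [mderivList_cons, mderivList_cons]
    by_cases hij : j = i
    · subst hij
      rw [mderivList_add_single_of_notMem G α hs.1, Pi.add_apply, Pi.single_eq_same,
        Function.iterate_succ_apply']
    · rw [ih hs.2 ((List.mem_cons.1 hj).resolve_left hij), Pi.add_apply,
        Pi.single_eq_of_ne (Ne.symm hij), add_zero,
        iterate_pderiv1_comm (contDiff_mderivList hG s α)]

theorem mderiv_eq_mderivList (α : Fin n → ℕ) (f : (Fin n → ℝ) → ℝ) :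
    mderiv α f = mderivList (List.finRange n) α f := rfl

theorem mderiv_add_single {G : (Fin n → ℝ) → ℝ} (hG : ContDiff ℝ (⊤ : ℕ∞) G)
    (α : Fin n → ℕ) (j : Fin n) :
    mderiv (α + Pi.single j 1) G = mderiv α (pderiv1 j G) := by
  rw [mderiv_eq_mderivList, mderiv_eq_mderivList, mderivList_pderiv1 hG,
    mderivList_add_single hG (List.nodup_finRange n) α (List.mem_finRange j)]

theorem mderiv_zero (G : (Fin n → ℝ) → ℝ) : mderiv 0 G = G := by
  rw [mderiv_eq_mderivList]
  induction List.finRange n with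
  | nil => rfl
  | cons i s ih => rw [mderivList_cons, ih]; rfl

theorem pderiv1_congr {f g : (Fin n → ℝ) → ℝ} {x : Fin n → ℝ} (h : f =ᶠ[𝓝 x] g) (i : Fin n) :
    pderiv1 i f =ᶠ[𝓝 x] pderiv1 i g := by
  filter_upwards [h.eventuallyEq_nhds] with y hy
  rw [pderiv1, pderiv1, hy.fderiv_eq]

theorem mderiv_congr {f g : (Fin n → ℝ) → ℝ} {x : Fin n → ℝ} (h : f =ᶠ[𝓝 x] g)
    (α : Fin n → ℕ) : mderiv α f =ᶠ[𝓝 x] mderiv α g := by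
  rw [mderiv_eq_mderivList, mderiv_eq_mderivList]
  induction List.finRange n with
  | nil => exact h
  | cons i s ih =>
    rw [mderivList_cons, mderivList_cons]
    generalize α i = k
    induction k with
    | zero => exact ih
    | succ k ihk =>
      rw [Function.iterate_succ_apply', Function.iterate_succ_apply']
      exact pderiv1_congr ihk i

theorem taylorCoeff_congr {f g : (Fin n → ℝ) → ℝ} (h : f =ᶠ[𝓝 0] g) (α : Fin n → ℕ) :
    taylorCoeff f α = taylorCoeff g α := by
  rw [taylorCoeff, taylorCoeff, (mderiv_congr h α).eq_of_nhds]

/-- Multi-indices are built from `0` by incrementing one entry at a time. -/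
theorem multiIndex_induction {p : (Fin n → ℕ) → Prop} (zero : p 0)
    (succ : ∀ α j, p α → p (α + Pi.single j 1)) (α : Fin n → ℕ) : p α := by
  induction hN : ∑ i, α i generalizing α with
  | zero =>
    have : α = 0 := funext fun i => by
      have : ∀ i, α i = 0 := by simpa using hN
      exact this i
    exact this ▸ zero
  | succ N ih =>
    obtain ⟨j, hj⟩ : ∃ j, α j ≠ 0 := by
      by_contra! hcon
      simp [hcon] at hN
    have hα : (α - Pi.single j 1) + Pi.single j 1 = α := funext fun i => by
      by_cases hi : i = j
      · subst hi; simp; omega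
      · simp [Pi.single_eq_of_ne hi]
    rw [← hα]
    refine succ _ _ (ih _ ?_)
    have := congrArg (fun β : Fin n → ℕ => ∑ i, β i) hα
    simp only [Pi.add_apply, Finset.sum_add_distrib, Finset.sum_pi_single', Finset.mem_univ,
      if_true, hN] at this
    omega

theorem pderiv1_sum {ι : Type} (F : Finset ι) (c : ι → ℝ) (g : ι → (Fin n → ℝ) → ℝ)
    (hg : ∀ k ∈ F, ContDiff ℝ (⊤ : ℕ∞) (g k)) (i : Fin n) :
    pderiv1 i (fun x => ∑ k ∈ F, c k * g k x) = fun x => ∑ k ∈ F, c k * pderiv1 i (g k) x := by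
  funext x
  have h := HasFDerivAt.fun_sum (u := F) (A := fun k x => c k * g k x) (x := x)
    (A' := fun k => c k • fderiv ℝ (g k) x) fun k hk =>
      (((hg k hk).differentiable (by simp) x).hasFDerivAt).const_mul (c k)
  rw [pderiv1, h.fderiv]
  simp [pderiv1]

theorem mderiv_sum {ι : Type} (F : Finset ι) (c : ι → ℝ) (α : Fin n → ℕ) :
    ∀ (g : ι → (Fin n → ℝ) → ℝ), (∀ k ∈ F, ContDiff ℝ (⊤ : ℕ∞) (g k)) →
    mderiv α (fun x => ∑ k ∈ F, c k * g k x) = fun x => ∑ k ∈ F, c k * mderiv α (g k) x := by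
  induction α using multiIndex_induction with
  | zero => intro g _; simp only [mderiv_zero]
  | succ α j ih =>
    intro g hg
    rw [mderiv_add_single (ContDiff.sum fun k hk => contDiff_const.mul (hg k hk)),
      pderiv1_sum F c g hg, ih _ fun k hk => contDiff_pderiv1 (hg k hk) j]
    funext x
    refine Finset.sum_congr rfl fun k hk => ?_
    rw [mderiv_add_single (hg k hk)]

theorem mderiv_sub (α : Fin n → ℕ) {g h : (Fin n → ℝ) → ℝ} (hg : ContDiff ℝ (⊤ : ℕ∞) g)
    (hh : ContDiff ℝ (⊤ : ℕ∞) h) :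
    mderiv α (fun x => g x - h x) = fun x => mderiv α g x - mderiv α h x := by
  have := mderiv_sum (Finset.univ : Finset (Fin 2)) ![1, -1] α ![g, h] (fun k _ => by
    fin_cases k <;> assumption)
  simpa [← sub_eq_add_neg] using this

/-- The monomial `x^α`. -/
def mono (α : Fin n → ℕ) (x : Fin n → ℝ) : ℝ := ∏ i, x i ^ α i

theorem contDiff_mono (α : Fin n → ℕ) {k : WithTop ℕ∞} : ContDiff ℝ k (mono α) :=
  contDiff_prod fun i _ => (contDiff_apply ℝ ℝ i).pow _

theorem mono_update (α : Fin n → ℕ) (x : Fin n → ℝ) (j : Fin n) (s : ℝ) :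
    mono α (Function.update x j s) = s ^ α j * ∏ i ∈ Finset.univ.erase j, x i ^ α i := by
  rw [mono, ← Finset.mul_prod_erase _ _ (Finset.mem_univ j), Function.update_self]
  congr 1
  exact Finset.prod_congr rfl fun i hi => by rw [Function.update_of_ne (Finset.ne_of_mem_erase hi)]

theorem pderiv1_eq_deriv_update {g : (Fin n → ℝ) → ℝ} {x : Fin n → ℝ}
    (hg : DifferentiableAt ℝ g x) (j : Fin n) :
    pderiv1 j g x = deriv (fun s => g (Function.update x j s)) (x j) := by
  have h1 : HasFDerivAt g (fderiv ℝ g x) (Function.update x j (x j)) := by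
    rw [Function.update_eq_self]; exact hg.hasFDerivAt
  exact ((h1.comp_hasDerivAt (x j) (hasDerivAt_update x j (x j))).deriv).symm

theorem pderiv1_mono (α : Fin n → ℕ) (j : Fin n) :
    pderiv1 j (mono α) = fun x => (α j : ℝ) * mono (α - Pi.single j 1) x := by
  funext x
  rw [pderiv1_eq_deriv_update ((contDiff_mono (k := 1) α).differentiable one_ne_zero x)]
  simp only [mono_update]
  have h2 : mono (α - Pi.single j 1) x =
      x j ^ (α j - 1) * ∏ i ∈ Finset.univ.erase j, x i ^ α i := by
    have := mono_update (α - Pi.single j 1) x j (x j)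
    rw [Function.update_eq_self] at this
    rw [this]
    congr 1
    · simp
    · exact Finset.prod_congr rfl fun i hi => by
        simp [Pi.single_eq_of_ne (Finset.ne_of_mem_erase hi)]
  rw [h2, deriv_mul_const (by fun_prop)]
  simp
  ring

theorem mderiv_mono_zero (β : Fin n → ℕ) : ∀ α : Fin n → ℕ,
    mderiv β (mono α) 0 = if α = β then ((∏ i, Nat.factorial (β i) : ℕ) : ℝ) else 0 := by
  induction β using multiIndex_induction with
  | zero =>
    intro α
    rw [mderiv_zero, mono]
    split_ifs with h
    · simp [h]
    · obtain ⟨i, hi⟩ := Function.ne_iff.1 h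
      exact Finset.prod_eq_zero (Finset.mem_univ i) (by simpa using hi)
  | succ β j ih =>
    intro α
    rw [mderiv_add_single (contDiff_mono α), pderiv1_mono]
    have := mderiv_sum {()} (fun _ => (α j : ℝ)) β (fun _ => mono (α - Pi.single j 1))
      fun _ _ => contDiff_mono _
    simp only [Finset.sum_singleton] at this
    rw [this]
    simp only [ih]
    by_cases hα : α j = 0
    · rw [if_neg (show ¬ α = β + Pi.single j 1 from fun h => by simp [h] at hα), hα]
      simp
    · have hiff : α - Pi.single j 1 = β ↔ α = β + Pi.single j 1 := by
        constructor
        · rintro rfl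
          funext i
          by_cases hi : i = j
          · subst hi; simp; omega
          · simp [Pi.single_eq_of_ne hi]
        · rintro rfl
          funext i
          simp
      simp only [hiff]
      split_ifs with h
      · subst h
        have hp : ∏ i, ((β + Pi.single j 1 : Fin n → ℕ) i).factorial =
            (β j + 1) * ∏ i, (β i).factorial := by
          rw [← Finset.mul_prod_erase _ _ (Finset.mem_univ j),
            ← Finset.mul_prod_erase _ (fun i => (β i).factorial) (Finset.mem_univ j),
            Pi.add_apply, Pi.single_eq_same, Nat.factorial_succ, mul_assoc]
          congr 2
          exact Finset.prod_congr rfl fun i hi => by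
            simp [Pi.single_eq_of_ne (Finset.ne_of_mem_erase hi)]
        refine Eq.trans ?_ (congrArg (Nat.cast (R := ℝ)) hp).symm
        simp
      · simp

end PartialDerivatives

section Taylor

open Asymptotics

theorem norm_fderiv_le_sum_pderiv1 (G : (Fin n → ℝ) → ℝ) (x : Fin n → ℝ) :
    ‖fderiv ℝ G x‖ ≤ ∑ i, ‖pderiv1 i G x‖ := by
  refine ContinuousLinearMap.opNorm_le_bound _ (Finset.sum_nonneg fun _ _ => norm_nonneg _)
    fun v => ?_
  have hv : v = ∑ i, v i • (Pi.single i (1:ℝ) : Fin n → ℝ) := by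
    simpa [← Pi.single_smul'] using (Finset.univ_sum_single v).symm
  calc ‖fderiv ℝ G x v‖ = ‖∑ i, v i • pderiv1 i G x‖ := by
        conv_lhs => rw [hv, map_sum]
        simp only [map_smul, pderiv1]
    _ ≤ ∑ i, ‖v i • pderiv1 i G x‖ := norm_sum_le _ _
    _ ≤ ∑ i, ‖pderiv1 i G x‖ * ‖v‖ := Finset.sum_le_sum fun i _ => by
        rw [norm_smul, mul_comm]
        exact mul_le_mul_of_nonneg_left (norm_le_pi_norm v i) (norm_nonneg _)
    _ = _ := (Finset.sum_mul ..).symm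

/-- A smooth function all of whose derivatives of order at most `N` vanish at the origin
is `O(‖x‖^{N+1})`. -/
theorem isBigO_of_mderiv_eq_zero (N : ℕ) : ∀ G : (Fin n → ℝ) → ℝ, ContDiff ℝ (⊤ : ℕ∞) G →
    (∀ α : Fin n → ℕ, ∑ i, α i ≤ N → mderiv α G 0 = 0) →
    G =O[𝓝 0] fun x => ‖x‖ ^ (N + 1) := by
  induction N with
  | zero =>
    intro G hG h0
    have h00 : G 0 = 0 := by simpa [mderiv_zero] using h0 0 (by simp)
    have := (hG.differentiable (by simp) 0).isBigO_sub
    simpa [h00] using this.norm_right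
  | succ N ih =>
    intro G hG h0
    have h00 : G 0 = 0 := by simpa [mderiv_zero] using h0 0 (by simp)
    have h1 : ∀ i, pderiv1 i G =O[𝓝 0] fun x => ‖x‖ ^ (N + 1) := fun i =>
      ih _ (contDiff_pderiv1 hG i) fun α hα => by
        rw [← mderiv_add_single hG]
        refine h0 _ ?_
        simp only [Pi.add_apply, Finset.sum_add_distrib, Finset.sum_pi_single', Finset.mem_univ,
          if_true]
        omega
    have h2 : (fun x => ∑ i, ‖pderiv1 i G x‖) =O[𝓝 0] fun x => ‖x‖ ^ (N + 1) :=
      IsBigO.fun_sum fun i _ => (h1 i).norm_left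
    have h3 : fderiv ℝ G =O[𝓝 0] fun x => ‖x‖ ^ (N + 1) := by
      refine IsBigO.trans (IsBigO.of_bound 1 (Eventually.of_forall fun x => ?_)) h2
      rw [one_mul]
      exact (norm_fderiv_le_sum_pderiv1 G x).trans (le_abs_self _)
    obtain ⟨C, hC⟩ := h3.bound
    obtain ⟨r, hr, hrC⟩ := Metric.eventually_nhds_iff_ball.1 hC
    refine IsBigO.of_bound |C| ?_
    filter_upwards [Metric.ball_mem_nhds (0 : Fin n → ℝ) hr] with x hx
    have hxr : ‖x‖ < r := by simpa using hx
    have hC0 : ∀ y ∈ Metric.closedBall (0 : Fin n → ℝ) ‖x‖,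
        ‖fderiv ℝ G y‖ ≤ |C| * ‖x‖ ^ (N + 1) := fun y hy => by
      have hy' : ‖y‖ ≤ ‖x‖ := by simpa using hy
      have := hrC y (by simpa using hy'.trans_lt hxr)
      rw [norm_pow, norm_norm] at this
      exact this.trans (mul_le_mul (le_abs_self C) (pow_le_pow_left₀ (norm_nonneg _) hy' _)
        (by positivity) (abs_nonneg _))
    have hmv := (convex_closedBall (0 : Fin n → ℝ) ‖x‖).norm_image_sub_le_of_norm_fderiv_le
      (fun y _ => hG.differentiable (by simp) y) hC0 (Metric.mem_closedBall_self (norm_nonneg x))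
      (show x ∈ Metric.closedBall 0 ‖x‖ by simp)
    rw [h00, sub_zero, sub_zero] at hmv
    rw [norm_pow, norm_norm, pow_succ, ← mul_assoc]
    exact hmv

/-- Taylor's formula with multi-index coefficients. -/
theorem taylor_isBigO {G : (Fin n → ℝ) → ℝ} (hG : ContDiff ℝ (⊤ : ℕ∞) G) (N : ℕ)
    (F : Finset (Fin n → ℕ)) (hF : ∀ α : Fin n → ℕ, ∑ i, α i ≤ N → α ∈ F) :
    (fun x => G x - ∑ α ∈ F, taylorCoeff G α * mono α x) =O[𝓝 0] fun x => ‖x‖ ^ (N + 1) := by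
  have hP : ContDiff ℝ (⊤ : ℕ∞) fun x => ∑ α ∈ F, taylorCoeff G α * mono α x :=
    ContDiff.sum fun α _ => contDiff_const.mul (contDiff_mono α)
  refine isBigO_of_mderiv_eq_zero N _ (hG.sub hP) fun β hβ => ?_
  rw [mderiv_sub β hG hP, mderiv_sum F _ β mono fun α _ => contDiff_mono α]
  simp only [mderiv_mono_zero, mul_ite, mul_zero, Finset.sum_ite_eq', hF β hβ, if_true]
  rw [taylorCoeff, div_mul_cancel₀, sub_self]
  exact_mod_cast Finset.prod_ne_zero_iff.2 fun i _ => Nat.factorial_ne_zero _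

theorem mono_scaleAction (α a : Fin n → ℕ) (s : ℝ) (x : Fin n → ℝ) :
    mono α (scaleAction a s x) = s ^ (∑ i, a i * α i) * mono α x := by
  simp only [mono, scaleAction, mul_pow, Finset.prod_mul_distrib, ← pow_mul,
    Finset.prod_pow_eq_pow_sum]

/-- The quasihomogeneous part of lowest degree with respect to a positive weight is the leading
term of a smooth function along the orbits of the corresponding dilation. -/
theorem tendsto_scaleAction_div {U : Set (Fin n → ℝ)} (hU : IsOpen U)
    (hU0 : (0 : Fin n → ℝ) ∈ U) {f : (Fin n → ℝ) → ℝ} (hf : ContDiffOn ℝ (⊤ : ℕ∞) f U)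
    (a : Fin n → ℕ) (ha : ∀ i, 0 < a i) (l : ℕ)
    (hl : ∀ α, taylorCoeff f α ≠ 0 → l ≤ ∑ i, a i * α i)
    (F : Finset (Fin n → ℕ)) (hF : ∀ α : Fin n → ℕ, ∑ i, α i ≤ l → α ∈ F) (x : Fin n → ℝ) :
    Tendsto (fun s : ℝ => f (scaleAction a s x) / s ^ l) (𝓝[>] 0)
      (𝓝 (∑ α ∈ F, if ∑ i, a i * α i = l then taylorCoeff f α * mono α x else 0)) := by
  obtain ⟨G, hG, hGf⟩ := exists_contDiff_eventuallyEq hU hf hU0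
  have hscale : Tendsto (fun s : ℝ => scaleAction a s x) (𝓝[>] 0) (𝓝 0) := by
    have hc : Continuous fun s : ℝ => scaleAction a s x :=
      continuous_pi fun i => by unfold scaleAction; fun_prop
    have h0 : scaleAction a 0 x = 0 := funext fun i => by
      simp [scaleAction, (ha i).ne']
    simpa only [h0] using (hc.tendsto 0).mono_left (nhdsWithin_le_nhds (s := Set.Ioi 0))
  have hpos : ∀ᶠ s in 𝓝[>] (0:ℝ), 0 < s := self_mem_nhdsWithin
  have hlt : ∀ᶠ s in 𝓝[>] (0:ℝ), s < 1 :=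
    (eventually_lt_nhds one_pos).filter_mono nhdsWithin_le_nhds
  have hidf : Tendsto (fun s : ℝ => s) (𝓝[>] 0) (𝓝 0) := nhdsWithin_le_nhds
  have hR := (taylor_isBigO hG l F hF).comp_tendsto hscale
  have hR' : Tendsto (fun s : ℝ => (G (scaleAction a s x) -
      ∑ α ∈ F, taylorCoeff G α * mono α (scaleAction a s x)) / s ^ l) (𝓝[>] 0) (𝓝 0) := by
    have h1 : (fun s : ℝ => ‖scaleAction a s x‖ ^ (l + 1)) =O[𝓝[>] 0] fun s => s ^ (l + 1) := by
      refine IsBigO.pow (IsBigO.of_bound ‖x‖ ?_) _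
      filter_upwards [hpos, hlt] with s hs hs1
      rw [norm_norm]
      refine (pi_norm_le_iff_of_nonneg (by positivity)).2 fun i => ?_
      rw [scaleAction, norm_mul, norm_pow, mul_comm]
      refine mul_le_mul (norm_le_pi_norm x i) ?_ (by positivity) (norm_nonneg _)
      refine pow_le_of_le_one (norm_nonneg _) ?_ (ha i).ne'
      rw [Real.norm_of_nonneg hs.le]; exact hs1.le
    have h2 : (fun s : ℝ => s ^ (l + 1)) =o[𝓝[>] 0] fun s => s ^ l :=
      (isLittleO_pow_pow (Nat.lt_succ_self l)).mono nhdsWithin_le_nhds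
    exact ((hR.trans h1).trans_isLittleO h2).tendsto_div_nhds_zero
  have hS : Tendsto (fun s : ℝ => ∑ α ∈ F, taylorCoeff f α * mono α (scaleAction a s x) / s ^ l)
      (𝓝[>] 0) (𝓝 (∑ α ∈ F, if ∑ i, a i * α i = l then taylorCoeff f α * mono α x else 0)) := by
    refine tendsto_finsetSum _ fun α _ => ?_
    simp only [mono_scaleAction]
    by_cases hc : taylorCoeff f α = 0
    · simp [hc]
    obtain ⟨m, hm⟩ := Nat.exists_eq_add_of_le (hl α hc)
    have heq : ∀ᶠ s : ℝ in 𝓝[>] 0, s ^ m * (taylorCoeff f α * mono α x) =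
        taylorCoeff f α * (s ^ (∑ i, a i * α i) * mono α x) / s ^ l := by
      filter_upwards [hpos] with s hs
      rw [hm, pow_add]
      field_simp
    refine Tendsto.congr' heq ?_
    rcases Nat.eq_zero_or_pos m with h0 | h0
    · rw [if_pos (by omega)]
      simp [h0]
    · rw [if_neg (by omega)]
      have := (hidf.pow m).mul_const (taylorCoeff f α * mono α x)
      simpa [h0.ne'] using this
  have := hR'.add hS
  rw [zero_add] at this
  refine this.congr' ?_
  filter_upwards [hscale.eventually hGf] with s hs
  rw [← Finset.sum_div, ← add_div, hs]
  simp only [taylorCoeff_congr hGf, sub_add_cancel]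

end Taylor

section NewtonPolyhedra

theorem dot_natPt (b α : Fin n → ℕ) :
    dot (natPt b) (natPt α) = ((∑ i, b i * α i : ℕ) : ℝ) := by
  simp [dot, natPt]

theorem dot_add (a x y : Fin n → ℝ) : dot a (x + y) = dot a x + dot a y := by
  simp [dot, mul_add, Finset.sum_add_distrib]

theorem dot_smul (a x : Fin n → ℝ) (c : ℝ) : dot a (c • x) = c * dot a x := by
  simp only [dot, Pi.smul_apply, smul_eq_mul, Finset.mul_sum]
  exact Finset.sum_congr rfl fun i _ => by ring

theorem dot_natPt_mono (b : Fin n → ℕ) {x y : Fin n → ℝ} (h : ∀ i, x i ≤ y i) :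
    dot (natPt b) x ≤ dot (natPt b) y :=
  Finset.sum_le_sum fun i _ => mul_le_mul_of_nonneg_left (h i) (Nat.cast_nonneg _)

theorem convex_Hhalf (a : Fin n → ℝ) (l : ℝ) : Convex ℝ (Hhalf a l) := by
  intro x hx y hy p q hp hq hpq
  simp only [Hhalf, Set.mem_ofPred_eq] at *
  rw [dot_add, dot_smul, dot_smul]
  have h1 := mul_le_mul_of_nonneg_left hx hp
  have h2 := mul_le_mul_of_nonneg_left hy hq
  have hl : p * l + q * l = l := by rw [← add_mul, hpq, one_mul]
  linarith

theorem natPt_mem_newtonPolyhedron {f : (Fin n → ℝ) → ℝ} {α : Fin n → ℕ}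
    (h : taylorCoeff f α ≠ 0) : natPt α ∈ NewtonPolyhedron f :=
  subset_convexHull ℝ _ ⟨α, h, fun _ => le_rfl⟩

theorem newtonPolyhedron_subset_Hhalf {f : (Fin n → ℝ) → ℝ} (b : Fin n → ℕ) (l : ℝ)
    (h : ∀ α, taylorCoeff f α ≠ 0 → l ≤ dot (natPt b) (natPt α)) :
    NewtonPolyhedron f ⊆ Hhalf (natPt b) l := by
  refine convexHull_min ?_ (convex_Hhalf _ _)
  rintro x ⟨α, hα, hx⟩
  exact (h α hα).trans (dot_natPt_mono b hx)

theorem newtonPolyhedron_subset_Hhalf_lval (f : (Fin n → ℝ) → ℝ) (b : Fin n → ℕ) :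
    NewtonPolyhedron f ⊆ Hhalf (natPt b) (lval (NewtonPolyhedron f) (natPt b)) := by
  have h0 : NewtonPolyhedron f ⊆ Hhalf (natPt b) 0 :=
    newtonPolyhedron_subset_Hhalf b 0 fun α _ => by rw [dot_natPt]; positivity
  have hbdd : BddBelow (dot (natPt b) '' NewtonPolyhedron f) :=
    ⟨0, by rintro _ ⟨y, hy, rfl⟩; exact h0 hy⟩
  exact fun x hx => csInf_le hbdd (Set.mem_image_of_mem _ hx)

theorem isFaceOf_inter_Hplane {P : Set (Fin n → ℝ)} {b : Fin n → ℕ} {l : ℕ}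
    (h : P ⊆ Hhalf (natPt b) l) : IsFaceOf P (P ∩ Hplane (natPt b) l) :=
  ⟨fun i => (b i : ℤ), (l : ℤ), h, rfl⟩

theorem sum_le_sum_mul {b : Fin n → ℕ} (hb : ∀ i, 0 < b i) (α : Fin n → ℕ) :
    ∑ i, α i ≤ ∑ i, b i * α i :=
  Finset.sum_le_sum fun i _ => Nat.le_mul_of_pos_left _ (hb i)

/-- The multi-indices all of whose entries are at most `l`. -/
def multiIndexBox (n l : ℕ) : Finset (Fin n → ℕ) :=
  Fintype.piFinset fun _ => Finset.range (l + 1)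

theorem mem_multiIndexBox {l : ℕ} {α : Fin n → ℕ} (h : ∑ i, α i ≤ l) :
    α ∈ multiIndexBox n l :=
  Fintype.mem_piFinset.2 fun i => Finset.mem_range.2 <| Nat.lt_succ_of_le <|
    (Finset.single_le_sum (f := α) (fun _ _ => Nat.zero_le _) (Finset.mem_univ i)).trans h

theorem isCompact_newtonPolyhedron_inter_Hplane {f : (Fin n → ℝ) → ℝ} {b : Fin n → ℕ}
    (hb : ∀ i, 0 < b i) {l : ℕ} (h : NewtonPolyhedron f ⊆ Hhalf (natPt b) l) :
    IsCompact (NewtonPolyhedron f ∩ Hplane (natPt b) l) := by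
  set T : Set (Fin n → ℕ) := {α | taylorCoeff f α ≠ 0 ∧ ∑ i, b i * α i = l} with hT
  have hTfin : T.Finite := (multiIndexBox n l).finite_toSet.subset fun α hα =>
    mem_multiIndexBox ((sum_le_sum_mul hb α).trans hα.2.le)
  suffices hK : NewtonPolyhedron f ∩ Hplane (natPt b) l = convexHull ℝ (natPt '' T) by
    rw [hK]; exact (hTfin.image _).isCompact_convexHull ℝ
  refine Set.Subset.antisymm ?_ ?_
  · have hsub : NewtonPolyhedron f ⊆
        {x | (l : ℝ) ≤ dot (natPt b) x ∧
          (dot (natPt b) x = l → x ∈ convexHull ℝ (natPt '' T))} := by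
      refine convexHull_min ?_ ?_
      · rintro x ⟨α, hα, hx⟩
        have h1 : (l : ℝ) ≤ dot (natPt b) (natPt α) := h (natPt_mem_newtonPolyhedron hα)
        have h2 : dot (natPt b) (natPt α) ≤ dot (natPt b) x := dot_natPt_mono b hx
        refine ⟨h1.trans h2, fun he => subset_convexHull ℝ _ ⟨α, ⟨hα, ?_⟩, ?_⟩⟩
        · have : dot (natPt b) (natPt α) = l := le_antisymm (h2.trans he.le) h1
          rw [dot_natPt] at this
          exact_mod_cast this
        · have hsum : ∑ i, (natPt b i * x i - natPt b i * natPt α i) = 0 := by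
            rw [Finset.sum_sub_distrib]
            have : dot (natPt b) x = dot (natPt b) (natPt α) := by linarith
            exact sub_eq_zero.2 this
          have hnn : ∀ i ∈ Finset.univ, 0 ≤ natPt b i * x i - natPt b i * natPt α i :=
            fun i _ => sub_nonneg.2 (mul_le_mul_of_nonneg_left (hx i) (Nat.cast_nonneg _))
          have hzero := (Finset.sum_eq_zero_iff_of_nonneg hnn).1 hsum
          funext i
          have hbi : natPt b i ≠ 0 := Nat.cast_ne_zero.2 (hb i).ne'
          exact (mul_left_cancel₀ hbi (sub_eq_zero.1 (hzero i (Finset.mem_univ i)))).symm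
      · intro x hx y hy p q hp hq hpq
        refine ⟨convex_Hhalf _ _ hx.1 hy.1 hp hq hpq, fun he => ?_⟩
        rcases hp.eq_or_lt with rfl | hp
        · obtain rfl : q = 1 := by linarith
          simp only [zero_smul, one_smul, zero_add] at he ⊢
          exact hy.2 he
        rcases hq.eq_or_lt with rfl | hq
        · obtain rfl : p = 1 := by linarith
          simp only [zero_smul, one_smul, add_zero] at he ⊢
          exact hx.2 he
        rw [dot_add, dot_smul, dot_smul] at he
        have h1 := mul_le_mul_of_nonneg_left hx.1 hp.le
        have h2 := mul_le_mul_of_nonneg_left hy.1 hq.le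
        have hl : p * (l : ℝ) + q * l = l := by rw [← add_mul, hpq, one_mul]
        exact convex_convexHull ℝ _
          (hx.2 (mul_left_cancel₀ hp.ne' (by linarith)))
          (hy.2 (mul_left_cancel₀ hq.ne' (by linarith))) hp.le hq.le hpq
    exact fun x hx => (hsub hx.1).2 hx.2
  · refine Set.subset_inter ?_ ?_
    · refine convexHull_min ?_ (convex_convexHull ℝ _)
      rintro _ ⟨α, hα, rfl⟩
      exact natPt_mem_newtonPolyhedron hα.1
    · refine convexHull_min ?_ ?_
      · rintro _ ⟨α, hα, rfl⟩
        simp only [Hplane, Set.mem_ofPred_eq, dot_natPt, hα.2]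
      · intro x hx y hy p q _ _ hpq
        simp only [Hplane, Set.mem_ofPred_eq] at *
        rw [dot_add, dot_smul, dot_smul, hx, hy, ← add_mul, hpq, one_mul]

/-- On a face cut out by a positive weight, the `γ`-part polynomial is the finite sum over
the multi-indices of that weight. -/
theorem gammaPartPoly_inter_Hplane (f : (Fin n → ℝ) → ℝ) {b : Fin n → ℕ}
    (hb : ∀ i, 0 < b i) (l : ℕ) (x : Fin n → ℝ) :
    gammaPartPoly f (NewtonPolyhedron f ∩ Hplane (natPt b) l) x =
      ∑ α ∈ multiIndexBox n l,
        if ∑ i, b i * α i = l then taylorCoeff f α * mono α x else 0 := by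
  classical
  have hind : ∀ α : Fin n → ℕ,
      Set.indicator {α | natPt α ∈ NewtonPolyhedron f ∩ Hplane (natPt b) l}
        (fun α => taylorCoeff f α * mono α x) α =
      if ∑ i, b i * α i = l then taylorCoeff f α * mono α x else 0 := fun α => by
    have hpl : natPt α ∈ Hplane (natPt b) l ↔ ∑ i, b i * α i = l := by
      simp only [Hplane, Set.mem_ofPred_eq, dot_natPt]
      exact Nat.cast_inj
    by_cases hc : taylorCoeff f α = 0
    · simp [Set.indicator_apply, hc]
    · simp [Set.indicator_apply, Set.mem_inter_iff, hpl, natPt_mem_newtonPolyhedron hc]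
  have := tsum_subtype {α : Fin n → ℕ | natPt α ∈ NewtonPolyhedron f ∩ Hplane (natPt b) l}
    (fun α => taylorCoeff f α * mono α x)
  refine this.trans ?_
  simp only [hind]
  refine tsum_eq_sum fun α hα => if_neg fun h => hα ?_
  exact mem_multiIndexBox ((sum_le_sum_mul hb α).trans h.le)

end NewtonPolyhedra

section MonomialMap

/-- The monomial map whose `k`-th component is `∏ j, y j ^ a j k`. -/
def monoMap (a : Fin n → Fin n → ℕ) (y : Fin n → ℝ) : Fin n → ℝ :=
  fun k => ∏ j, y j ^ a j k

theorem contDiff_monoMap (a : Fin n → Fin n → ℕ) : ContDiff ℝ (⊤ : ℕ∞) (monoMap a) :=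
  contDiff_pi.2 fun k => contDiff_mono fun j => a j k

theorem monoMap_scale (a : Fin n → Fin n → ℕ) (I : Finset (Fin n)) (s : ℝ) (y : Fin n → ℝ) :
    monoMap a (fun j => (if j ∈ I then s else 1) * y j) =
      scaleAction (fun k => ∑ j ∈ I, a j k) s (monoMap a y) := by
  funext k
  simp only [monoMap, scaleAction, mul_pow, Finset.prod_mul_distrib, ite_pow, one_pow,
    Finset.prod_ite_mem, Finset.univ_inter, Finset.prod_pow_eq_pow_sum]

theorem monoMap_update_apply (a : Fin n → Fin n → ℕ) (y : Fin n → ℝ) (j k : Fin n) (s : ℝ) :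
    monoMap a (Function.update y j s) k =
      s ^ a j k * ∏ i ∈ Finset.univ.erase j, y i ^ a i k :=
  mono_update (fun i => a i k) y j s

theorem monoMap_update_mul (a : Fin n → Fin n → ℕ) (y : Fin n → ℝ) (j : Fin n) (t δ : ℝ) :
    monoMap a (Function.update y j (t * δ)) =
      scaleAction (a j) t (monoMap a (Function.update y j δ)) := by
  funext k
  rw [scaleAction, monoMap_update_apply, monoMap_update_apply, mul_pow, mul_assoc]

theorem eq_zero_of_dot_eq_zero {a : Fin n → Fin n → ℕ}
    (ha : (Matrix.det (Matrix.of fun j k => (a j k : ℤ))).natAbs = 1) {m : Fin n → ℝ}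
    (h : ∀ j, dot (natPt (a j)) m = 0) : m = 0 := by
  set M := Matrix.of fun j k => (a j k : ℤ) with hM
  have hdet : (M.map (Int.castRingHom ℝ)).det ≠ 0 := by
    rw [← RingHom.mapMatrix_apply, ← RingHom.map_det]
    intro h0
    have : M.det = 0 := by simpa using h0
    simp [this] at ha
  refine Matrix.eq_zero_of_mulVec_eq_zero hdet ?_
  funext j
  simpa [hM, Matrix.mulVec, dotProduct, dot, natPt] using h j

theorem dot_natPt_sum (a : Fin n → Fin n → ℕ) (I : Finset (Fin n)) (x : Fin n → ℝ) :
    dot (natPt fun k => ∑ j ∈ I, a j k) x = ∑ j ∈ I, dot (natPt (a j)) x := by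
  simp only [dot, natPt, Nat.cast_sum, Finset.sum_mul]
  exact Finset.sum_comm

theorem le_sum_of_taylorCoeff_ne_zero {f : (Fin n → ℝ) → ℝ} {b : Fin n → ℕ} {l : ℕ}
    (h : NewtonPolyhedron f ⊆ Hhalf (natPt b) l) {α : Fin n → ℕ} (hα : taylorCoeff f α ≠ 0) :
    l ≤ ∑ k, b k * α k := by
  have h1 : (l : ℝ) ≤ dot (natPt b) (natPt α) := h (natPt_mem_newtonPolyhedron hα)
  rw [dot_natPt] at h1
  exact_mod_cast h1

theorem newtonPolyhedron_subset_Hhalf_sum {f : (Fin n → ℝ) → ℝ} {a : Fin n → Fin n → ℕ}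
    {L : Fin n → ℕ} (hL : ∀ j, NewtonPolyhedron f ⊆ Hhalf (natPt (a j)) (L j))
    (I : Finset (Fin n)) :
    NewtonPolyhedron f ⊆ Hhalf (natPt fun k => ∑ j ∈ I, a j k) ((∑ j ∈ I, L j : ℕ) : ℝ) := by
  intro x hx
  simp only [Hhalf, Set.mem_ofPred_eq, dot_natPt_sum, Nat.cast_sum]
  exact Finset.sum_le_sum fun j _ => hL j hx

theorem exists_comp_monoMap_eq_mul {U : Set (Fin n → ℝ)} (hU : IsOpen U)
    {f : (Fin n → ℝ) → ℝ} (hf : MemEhatP (NewtonPolyhedron f) U f) {a : Fin n → Fin n → ℕ}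
    {L : Fin n → ℕ} (hL : ∀ j, NewtonPolyhedron f ⊆ Hhalf (natPt (a j)) (L j)) :
    ∃ g : (Fin n → ℝ) → ℝ, ContDiffOn ℝ (⊤ : ℕ∞) g (monoMap a ⁻¹' U) ∧
      ∀ y ∈ monoMap a ⁻¹' U, f (monoMap a y) = (∏ j, y j ^ L j) * g y := by
  have hV : IsOpen (monoMap a ⁻¹' U) := hU.preimage (contDiff_monoMap a).continuous
  refine exists_eq_monomial_mul hV _ L rfl (fun y => f (monoMap a y))
    (hf.1.comp (contDiff_monoMap a).contDiffOn fun _ h => h) ?_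
  intro j y hy hj _
  have hev : ∀ᶠ δ in 𝓝[>] (0 : ℝ), Function.update y j δ ∈ monoMap a ⁻¹' U :=
    (tendsto_update_nhdsGT y hj).eventually (hV.mem_nhds hy)
  obtain ⟨δ, hδU, hδ⟩ := (hev.and self_mem_nhdsWithin).exists
  replace hδ : 0 < δ := hδ
  obtain ⟨c, hc⟩ := hf.2.2 _ (isFaceOf_inter_Hplane (hL j)) _ hδU (a j) (L j) ⟨hL j, rfl⟩
  refine ⟨c / δ ^ L j, ?_⟩
  have ht : Tendsto (fun s : ℝ => s / δ) (𝓝[>] 0) (𝓝[>] 0) := by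
    refine tendsto_nhdsWithin_iff.2 ⟨?_, ?_⟩
    · have : Tendsto (fun s : ℝ => s / δ) (𝓝 0) (𝓝 (0 / δ)) := tendsto_id.div_const δ
      rw [zero_div] at this
      exact this.mono_left nhdsWithin_le_nhds
    · filter_upwards [self_mem_nhdsWithin] with s hs
      exact div_pos hs hδ
  refine ((hc.comp ht).div_const _).congr fun s => ?_
  simp only [Function.comp_apply]
  rw [← monoMap_update_mul, div_mul_cancel₀ _ hδ.ne', div_div, div_pow,
    div_mul_cancel₀ _ (pow_ne_zero _ hδ.ne')]

theorem monoMap_eq_zero {a : Fin n → Fin n → ℕ} {I : Finset (Fin n)}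
    (hI : ∀ k, ∃ j ∈ I, a j k ≠ 0) {y : Fin n → ℝ} (hy : ∀ j ∈ I, y j = 0) :
    monoMap a y = 0 := by
  funext k
  obtain ⟨j, hj, hjk⟩ := hI k
  exact Finset.prod_eq_zero (Finset.mem_univ j) (by rw [hy j hj, zero_pow hjk])

/-- The polynomial of the face cut out by the sum of the weights `a j`, `j ∈ I`, pulled back
by the monomial map, in terms of the strict transform on the stratum of `I`. -/
theorem gammaPartPoly_monoMap {U : Set (Fin n → ℝ)} (hU : IsOpen U)
    (hU0 : (0 : Fin n → ℝ) ∈ U) {f : (Fin n → ℝ) → ℝ} (hf : ContDiffOn ℝ (⊤ : ℕ∞) f U)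
    {a : Fin n → Fin n → ℕ} {L : Fin n → ℕ}
    (hL : ∀ j, NewtonPolyhedron f ⊆ Hhalf (natPt (a j)) (L j)) {g : (Fin n → ℝ) → ℝ}
    (hg : ContDiffOn ℝ (⊤ : ℕ∞) g (monoMap a ⁻¹' U))
    (hfg : ∀ y ∈ monoMap a ⁻¹' U, f (monoMap a y) = (∏ j, y j ^ L j) * g y)
    {I : Finset (Fin n)} (hI : ∀ k, ∃ j ∈ I, a j k ≠ 0) (z : Fin n → ℝ) :
    gammaPartPoly f (NewtonPolyhedron f ∩
        Hplane (natPt fun k => ∑ j ∈ I, a j k) ((∑ j ∈ I, L j : ℕ) : ℝ)) (monoMap a z) =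
      (∏ j, z j ^ L j) * g (fun j => if j ∈ I then 0 else z j) := by
  have hpos : ∀ k, 0 < ∑ j ∈ I, a j k := fun k => by
    obtain ⟨j, hj, hjk⟩ := hI k
    exact (Nat.pos_of_ne_zero hjk).trans_le
      (Finset.single_le_sum (f := fun j => a j k) (fun _ _ => Nat.zero_le _) hj)
  have hV : IsOpen (monoMap a ⁻¹' U) := hU.preimage (contDiff_monoMap a).continuous
  rw [gammaPartPoly_inter_Hplane f hpos]
  have h1 := tendsto_scaleAction_div hU hU0 hf _ hpos (∑ j ∈ I, L j)
    (fun α hα => le_sum_of_taylorCoeff_ne_zero (newtonPolyhedron_subset_Hhalf_sum hL I) hα)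
    (multiIndexBox n _) (fun α hα => mem_multiIndexBox hα) (monoMap a z)
  set c : ℝ → Fin n → ℝ := fun s j => (if j ∈ I then s else 1) * z j with hc
  have hc0 : c 0 = fun j => if j ∈ I then 0 else z j := by
    funext j
    by_cases hj : j ∈ I <;> simp [hc, hj]
  have hcc : Continuous c := continuous_pi fun j => by
    by_cases hj : j ∈ I
    · simpa [hc, hj] using continuous_mul_const (z j)
    · simpa [hc, hj] using continuous_const
  have hcV : c 0 ∈ monoMap a ⁻¹' U := by
    rw [Set.mem_preimage, monoMap_eq_zero hI fun j hj => by simp [hc, hj]]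
    exact hU0
  have hct : Tendsto c (𝓝[>] 0) (𝓝 (c 0)) := (hcc.tendsto 0).mono_left nhdsWithin_le_nhds
  have h2 : Tendsto (fun s => (∏ j, z j ^ L j) * g (c s)) (𝓝[>] 0)
      (𝓝 ((∏ j, z j ^ L j) * g (c 0))) :=
    ((hg.continuousOn.continuousAt (hV.mem_nhds hcV)).tendsto.comp hct).const_mul _
  rw [← hc0]
  refine tendsto_nhds_unique h1 (h2.congr' ?_)
  filter_upwards [hct.eventually (hV.mem_nhds hcV), self_mem_nhdsWithin] with s hs hs0
  have hs0' : s ^ (∑ j ∈ I, L j) ≠ 0 := pow_ne_zero _ (ne_of_gt hs0)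
  rw [← monoMap_scale, eq_div_iff hs0']
  change _ = f (monoMap a (c s))
  rw [hfg _ hs]
  have : ∏ j, c s j ^ L j = s ^ (∑ j ∈ I, L j) * ∏ j, z j ^ L j := by
    simp only [hc, mul_pow, Finset.prod_mul_distrib, ite_pow, one_pow,
      Finset.prod_ite_mem, Finset.univ_inter, Finset.prod_pow_eq_pow_sum]
  rw [this]
  ring

theorem exists_taylorCoeff_ne_zero {f : (Fin n → ℝ) → ℝ} {a : Fin n → Fin n → ℕ}
    {L : Fin n → ℕ} (hL : ∀ j, NewtonPolyhedron f ⊆ Hhalf (natPt (a j)) (L j))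
    {y : Fin n → ℝ} (hy : y ∈ NewtonPolyhedron f) (hyL : ∀ j, dot (natPt (a j)) y = L j) :
    ∃ p, taylorCoeff f p ≠ 0 ∧ ∀ j, ∑ k, a j k * p k = L j := by
  by_contra! hcon
  have hsub : NewtonPolyhedron f ⊆
      Hhalf (natPt fun k => ∑ j, a j k) (∑ j, (L j : ℝ) + 1) := by
    refine newtonPolyhedron_subset_Hhalf _ _ fun α hα => ?_
    obtain ⟨j₀, hj₀⟩ := hcon α hα
    have hlt : ∑ j, L j < ∑ j, ∑ k, a j k * α k :=
      Finset.sum_lt_sum (fun j _ => le_sum_of_taylorCoeff_ne_zero (hL j) hα)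
        ⟨j₀, Finset.mem_univ _,
          lt_of_le_of_ne (le_sum_of_taylorCoeff_ne_zero (hL j₀) hα) hj₀.symm⟩
    rw [dot_natPt_sum]
    simp only [dot_natPt]
    exact_mod_cast hlt
  have := hsub hy
  simp only [Hhalf, Set.mem_ofPred_eq, dot_natPt_sum, hyL] at this
  linarith

theorem exists_ne_zero_of_unimodular {a : Fin n → Fin n → ℕ}
    (ha : (Matrix.det (Matrix.of fun j k => (a j k : ℤ))).natAbs = 1) (k : Fin n) :
    ∃ j, a j k ≠ 0 := by
  by_contra! hcon
  have := eq_zero_of_dot_eq_zero ha (m := Pi.single k 1) fun j => by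
    simp [dot, natPt, Pi.single_apply, hcon j]
  simpa using congrFun this k

theorem strictTransform_zero_ne_zero {U : Set (Fin n → ℝ)} (hU : IsOpen U)
    (hU0 : (0 : Fin n → ℝ) ∈ U) {f : (Fin n → ℝ) → ℝ} (hf : ContDiffOn ℝ (⊤ : ℕ∞) f U)
    {a : Fin n → Fin n → ℕ}
    (ha : (Matrix.det (Matrix.of fun j k => (a j k : ℤ))).natAbs = 1) {L : Fin n → ℕ}
    (hL : ∀ j, NewtonPolyhedron f ⊆ Hhalf (natPt (a j)) (L j)) {g : (Fin n → ℝ) → ℝ}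
    (hg : ContDiffOn ℝ (⊤ : ℕ∞) g (monoMap a ⁻¹' U))
    (hfg : ∀ y ∈ monoMap a ⁻¹' U, f (monoMap a y) = (∏ j, y j ^ L j) * g y)
    {p : Fin n → ℕ} (hp : taylorCoeff f p ≠ 0) (hpL : ∀ j, ∑ k, a j k * p k = L j) :
    g 0 ≠ 0 := by
  have hI : ∀ k, ∃ j ∈ Finset.univ, a j k ≠ 0 := fun k => by
    simpa using exists_ne_zero_of_unimodular ha k
  have hpos : ∀ k, 0 < ∑ j, a j k := fun k => by
    obtain ⟨j, hj, hjk⟩ := hI k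
    exact (Nat.pos_of_ne_zero hjk).trans_le
      (Finset.single_le_sum (f := fun j => a j k) (fun _ _ => Nat.zero_le _) hj)
  have hswap : ∀ α : Fin n → ℕ, ∑ k, (∑ j, a j k) * α k = ∑ j, ∑ k, a j k * α k := fun α => by
    simp only [Finset.sum_mul]
    exact Finset.sum_comm
  have hpA : ∑ k, (∑ j, a j k) * p k = ∑ j, L j := by
    rw [hswap]
    exact Finset.sum_congr rfl fun j _ => hpL j
  have key := gammaPartPoly_monoMap hU hU0 hf hL hg hfg hI 1
  have hone : monoMap a 1 = 1 := by
    funext k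
    simp [monoMap]
  rw [gammaPartPoly_inter_Hplane f hpos, hone, Finset.sum_eq_single p] at key
  · rw [if_pos hpA] at key
    simp only [mono, Pi.one_apply, one_pow, Finset.prod_const_one, mul_one, one_mul,
      Finset.mem_univ, if_true] at key
    intro h0
    exact hp (key.trans h0)
  · intro α _ hαp
    refine ite_eq_right_iff.2 fun hα => ?_
    by_cases hc : taylorCoeff f α = 0
    · rw [hc, zero_mul]
    refine absurd ?_ hαp
    rw [hswap] at hα
    have hαL := (Finset.sum_eq_sum_iff_of_le
      fun j _ => le_sum_of_taylorCoeff_ne_zero (hL j) hc).1 hα.symm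
    have hz : natPt α - natPt p = 0 := eq_zero_of_dot_eq_zero ha fun j => by
      have e : dot (natPt (a j)) (natPt α) = dot (natPt (a j)) (natPt p) := by
        rw [dot_natPt, dot_natPt, ← hαL j (Finset.mem_univ j), hpL j]
      simp only [dot, Pi.sub_apply, mul_sub, Finset.sum_sub_distrib]
      exact sub_eq_zero.2 e
    funext k
    exact Nat.cast_injective (R := ℝ) (congrFun (sub_eq_zero.1 hz) k)
  · exact fun h => absurd (mem_multiIndexBox ((sum_le_sum_mul hpos p).trans hpA.le)) h

theorem differentiable_gammaPartPoly_inter_Hplane (f : (Fin n → ℝ) → ℝ) {b : Fin n → ℕ}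
    (hb : ∀ i, 0 < b i) (l : ℕ) :
    Differentiable ℝ (gammaPartPoly f (NewtonPolyhedron f ∩ Hplane (natPt b) l)) := by
  rw [funext (gammaPartPoly_inter_Hplane f hb l)]
  refine Differentiable.fun_sum fun α _ => ?_
  split_ifs
  · exact ((contDiff_mono α (k := 1)).differentiable one_ne_zero).const_mul _
  · exact differentiable_const _

theorem exists_pderiv1_strictTransform_ne_zero {U : Set (Fin n → ℝ)} (hU : IsOpen U)
    (hU0 : (0 : Fin n → ℝ) ∈ U) {f : (Fin n → ℝ) → ℝ} (hf : ContDiffOn ℝ (⊤ : ℕ∞) f U)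
    {a : Fin n → Fin n → ℕ}
    (ha : (Matrix.det (Matrix.of fun j k => (a j k : ℤ))).natAbs = 1) {L : Fin n → ℕ}
    (hL : ∀ j, NewtonPolyhedron f ⊆ Hhalf (natPt (a j)) (L j)) {g : (Fin n → ℝ) → ℝ}
    (hg : ContDiffOn ℝ (⊤ : ℕ∞) g (monoMap a ⁻¹' U))
    (hfg : ∀ y ∈ monoMap a ⁻¹' U, f (monoMap a y) = (∏ j, y j ^ L j) * g y)
    {p : Fin n → ℕ} (hp : taylorCoeff f p ≠ 0) (hpL : ∀ j, ∑ k, a j k * p k = L j)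
    (hnd : Nondegenerate f U) {I : Finset (Fin n)} (hI : ∀ k, ∃ j ∈ I, a j k ≠ 0)
    {y₀ : Fin n → ℝ} (hy₀ : ∀ i, y₀ i = 0 ↔ i ∈ I) (hgy₀ : g y₀ = 0) :
    ∃ i, i ∉ I ∧ pderiv1 i g y₀ ≠ 0 := by
  by_contra! hcon
  have hpos : ∀ k, 0 < ∑ j ∈ I, a j k := fun k => by
    obtain ⟨j, hj, hjk⟩ := hI k
    exact (Nat.pos_of_ne_zero hjk).trans_le
      (Finset.single_le_sum (f := fun j => a j k) (fun _ _ => Nat.zero_le _) hj)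
  have hV : IsOpen (monoMap a ⁻¹' U) := hU.preimage (contDiff_monoMap a).continuous
  have hsub := newtonPolyhedron_subset_Hhalf_sum hL I
  have hpγ : natPt p ∈ NewtonPolyhedron f ∩
      Hplane (natPt fun k => ∑ j ∈ I, a j k) ((∑ j ∈ I, L j : ℕ) : ℝ) := by
    refine ⟨natPt_mem_newtonPolyhedron hp, ?_⟩
    simp only [Hplane, Set.mem_ofPred_eq, dot_natPt_sum, dot_natPt, hpL, Nat.cast_sum]
  have hnd' := hnd _ (isFaceOf_inter_Hplane hsub) ⟨_, hpγ⟩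
    (isCompact_newtonPolyhedron_inter_Hplane hpos hsub)
  have hGd := differentiable_gammaPartPoly_inter_Hplane f hpos (∑ j ∈ I, L j)
  have key := gammaPartPoly_monoMap hU hU0 hf hL hg hfg hI
  set G := gammaPartPoly f (NewtonPolyhedron f ∩
    Hplane (natPt fun k => ∑ j ∈ I, a j k) ((∑ j ∈ I, L j : ℕ) : ℝ)) with hG
  have hy₀V : y₀ ∈ monoMap a ⁻¹' U := by
    rw [Set.mem_preimage, monoMap_eq_zero hI fun j hj => (hy₀ j).2 hj]
    exact hU0
  have hgd : HasFDerivAt g (fderiv ℝ g y₀) y₀ :=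
    ((hg.contDiffAt (hV.mem_nhds hy₀V)).differentiableAt (by simp)).hasFDerivAt
  obtain ⟨w, hwU, hw0, hwI⟩ : ∃ w : Fin n → ℝ, monoMap a w ∈ U ∧ (∀ j, w j ≠ 0) ∧
      ∀ j ∉ I, w j = y₀ j := by
    set c : ℝ → Fin n → ℝ := fun s j => if j ∈ I then s else y₀ j with hc
    have hc0 : c 0 = y₀ := by
      funext j
      by_cases hj : j ∈ I
      · simp [hc, hj, (hy₀ j).2 hj]
      · simp [hc, hj]
    have hcc : Continuous c := continuous_pi fun j => by
      by_cases hj : j ∈ I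
      · simpa [hc, hj] using continuous_id'
      · simpa [hc, hj] using continuous_const
    have hct : Tendsto c (𝓝[>] 0) (𝓝 y₀) := by
      rw [← hc0]
      exact (hcc.tendsto 0).mono_left nhdsWithin_le_nhds
    obtain ⟨s, hsV, hs⟩ := ((hct.eventually (hV.mem_nhds hy₀V)).and
      (self_mem_nhdsWithin : Set.Ioi (0 : ℝ) ∈ 𝓝[>] 0)).exists
    refine ⟨c s, hsV, fun j => ?_, fun j hj => by simp [hc, hj]⟩
    by_cases hj : j ∈ I
    · simpa [hc, hj] using ne_of_gt hs
    · simpa [hc, hj] using fun h => hj ((hy₀ j).1 h)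
  have hx0 : ∀ k, monoMap a w k ≠ 0 := fun k =>
    Finset.prod_ne_zero_iff.2 fun j _ => pow_ne_zero _ (hw0 j)
  have hlin : ∀ j, dot (natPt (a j)) (fun k => monoMap a w k * pderiv1 k G (monoMap a w)) = 0 := by
    intro j
    set C : Fin n → ℝ := fun k => ∏ i ∈ Finset.univ.erase j, w i ^ a i k with hC
    set v : Fin n → ℝ := fun k => (a j k * w j ^ (a j k - 1)) * C k with hv
    have hww : Function.update w j (w j) = w := Function.update_eq_self j w
    have hcurve : HasDerivAt (fun s => monoMap a (Function.update w j s)) v (w j) := by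
      refine hasDerivAt_pi.2 fun k => ?_
      simp only [monoMap_update_apply]
      exact (hasDerivAt_pow (a j k) (w j)).mul_const _
    have hLHS : HasDerivAt (fun s => G (monoMap a (Function.update w j s)))
        (fderiv ℝ G (monoMap a w) v) (w j) := by
      have hGx := (hGd (monoMap a w)).hasFDerivAt
      exact HasFDerivAt.comp_hasDerivAt_of_eq (w j) hGx hcurve (by rw [hww])
    have hTw : (fun i => if i ∈ I then 0 else w i) = y₀ := by
      funext i
      by_cases hi : i ∈ I
      · simp [hi, (hy₀ i).2 hi]
      · simp [hi, hwI i hi]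
    have hQ : HasDerivAt
        (fun s => g (fun i => if i ∈ I then 0 else Function.update w j s i)) 0 (w j) := by
      by_cases hj : j ∈ I
      · have : ∀ s, (fun i => if i ∈ I then 0 else Function.update w j s i) = y₀ := fun s => by
          rw [← hTw]
          funext i
          by_cases hi : i ∈ I
          · simp [hi]
          · simp [hi, Function.update_of_ne (ne_of_mem_of_not_mem hj hi).symm]
        simp only [this]
        exact hasDerivAt_const _ _
      · have : ∀ s, (fun i => if i ∈ I then 0 else Function.update w j s i) =
            Function.update y₀ j s := fun s => by
          rw [← hTw]
          funext i
          by_cases hij : i = j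
          · subst hij
            simp [hj]
          · simp [Function.update_of_ne hij]
        simp only [this]
        have := HasFDerivAt.comp_hasDerivAt_of_eq (w j) hgd (hasDerivAt_update y₀ j (w j))
          (by rw [hwI j hj, Function.update_eq_self])
        have h0 : fderiv ℝ g y₀ (Pi.single j 1) = 0 := hcon j hj
        rw [h0] at this
        exact this
    have hRHS : HasDerivAt (fun s => (∏ i, Function.update w j s i ^ L i) *
        g (fun i => if i ∈ I then 0 else Function.update w j s i)) 0 (w j) := by
      have hP : HasDerivAt (fun s => ∏ i, Function.update w j s i ^ L i)
          ((L j * w j ^ (L j - 1)) * ∏ i ∈ Finset.univ.erase j, w i ^ L i) (w j) := by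
        have : (fun s => ∏ i, Function.update w j s i ^ L i) =
            fun s => s ^ L j * ∏ i ∈ Finset.univ.erase j, w i ^ L i :=
          funext fun s => mono_update L w j s
        rw [this]
        exact (hasDerivAt_pow (L j) (w j)).mul_const _
      have := hP.mul hQ
      rw [hww, hTw, hgy₀, mul_zero, mul_zero, add_zero] at this
      exact this
    simp only [key] at hLHS
    have hzero : fderiv ℝ G (monoMap a w) v = 0 := hLHS.unique hRHS
    have hsum : fderiv ℝ G (monoMap a w) v = ∑ k, v k * pderiv1 k G (monoMap a w) := by
      have hvs : v = ∑ k, v k • (Pi.single k (1:ℝ) : Fin n → ℝ) := by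
        simpa [← Pi.single_smul'] using (Finset.univ_sum_single v).symm
      conv_lhs => rw [hvs]
      simp only [map_sum, map_smul, smul_eq_mul, pderiv1]
    have hvw : ∀ k, w j * v k = a j k * monoMap a w k := fun k => by
      have hxk : monoMap a w k = w j ^ a j k * C k := by
        conv_lhs => rw [← hww]
        exact monoMap_update_apply a w j k (w j)
      rw [hxk, hv]
      rcases Nat.eq_zero_or_pos (a j k) with h0 | h0
      · simp [h0]
      · have := pow_sub_one_mul h0.ne' (w j)
        linear_combination (a j k * C k) * this
    calc dot (natPt (a j)) (fun k => monoMap a w k * pderiv1 k G (monoMap a w))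
        = w j * ∑ k, v k * pderiv1 k G (monoMap a w) := by
          rw [dot, Finset.mul_sum]
          refine Finset.sum_congr rfl fun k _ => ?_
          rw [← mul_assoc, ← mul_assoc, hvw]
          rfl
      _ = 0 := by rw [← hsum, hzero, mul_zero]
  have hm := eq_zero_of_dot_eq_zero ha hlin
  refine hnd' _ hwU hx0 (norm_le_zero_iff.1 ((norm_fderiv_le_sum_pderiv1 G _).trans ?_))
  refine (Finset.sum_eq_zero fun k _ => ?_).le
  rw [(mul_eq_zero.1 (congrFun hm k)).resolve_left (hx0 k), norm_zero]

end MonomialMap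

/-- Theorem 8.10, toric resolution of singularities in `Ê(U)`: for
`f ∈ Ê(U)`, a simplicial subdivision `Σ` of the fan associated with `Γ₊(f)` and an
`n`-dimensional cone `σ` of `Σ` with skeleton `a¹(σ),…,aⁿ(σ)`, there is a `C^∞` function
`f_σ` on `π(σ)⁻¹(U)` with `f_σ(0) ≠ 0` and `f(π(σ)(y)) = (∏ y_j^{l(a^j(σ))}) f_σ(y)`;
moreover if `f` is nondegenerate and `π(σ)(T_I^*(ℝⁿ)) = {0}`, the zero set of `f_σ` in
`T_I^*(ℝⁿ)` is nonsingular. -/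
theorem statement7 {n : ℕ} (U : Set (Fin n → ℝ)) (hUopen : IsOpen U)
    (hU0 : (0 : Fin n → ℝ) ∈ U)
    (f : (Fin n → ℝ) → ℝ) (hf : MemEhat U f)
    (S : SimplicialSubdivision n (NewtonPolyhedron f)) (σ : S.ι)
    (π : (Fin n → ℝ) → (Fin n → ℝ))
    (hπ : π = fun y k => ∏ j, y j ^ (S.gen σ j k))
    (L : Fin n → ℕ)
    (hL : ∀ j, (L j : ℝ) = lval (NewtonPolyhedron f) (natPt (S.gen σ j))) :
    ∃ fσ : (Fin n → ℝ) → ℝ,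
      ContDiffOn ℝ (⊤ : ℕ∞) fσ (π ⁻¹' U) ∧ fσ 0 ≠ 0 ∧
      (∀ y ∈ π ⁻¹' U, f (π y) = (∏ j, y j ^ (L j)) * fσ y) ∧
      (Nondegenerate f U →
        ∀ I : Set (Fin n), π '' {y | ∀ i, y i = 0 ↔ i ∈ I} = {0} →
          ∀ y₀ : Fin n → ℝ, (∀ i, y₀ i = 0 ↔ i ∈ I) → fσ y₀ = 0 →
            ∃ p, p ∉ I ∧ pderiv1 p fσ y₀ ≠ 0) := by
  classical
  obtain ⟨γ, ⟨b, l, -, hγ⟩, ⟨y, hyγ⟩, hy⟩ := S.subordinate σ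
  have hyΓ : y ∈ NewtonPolyhedron f := (hγ.subset hyγ).1
  obtain ⟨he, -⟩ | ⟨-, hfP⟩ := hf
  · exact absurd (he ▸ hyΓ : y ∈ (∅ : Set (Fin n → ℝ))) (Set.notMem_empty y)
  set a := S.gen σ
  have hdet := S.unimodular σ
  replace hπ : π = monoMap a := hπ
  subst hπ
  have hLsub : ∀ j, NewtonPolyhedron f ⊆ Hhalf (natPt (a j)) (L j) := fun j => by
    rw [hL j]
    exact newtonPolyhedron_subset_Hhalf_lval f (a j)
  obtain ⟨p, hp, hpL⟩ := exists_taylorCoeff_ne_zero hLsub hyΓ fun j => by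
    rw [hL j]
    exact hy j y hyγ
  obtain ⟨g, hg, hfg⟩ := exists_comp_monoMap_eq_mul hUopen hfP hLsub
  refine ⟨g, hg, strictTransform_zero_ne_zero hUopen hU0 hfP.1 hdet hLsub hg hfg hp hpL, hfg,
    fun hnd I hI y₀ hy₀ hgy₀ => ?_⟩
  have hI' : ∀ k, ∃ j ∈ I.toFinset, a j k ≠ 0 := fun k => by
    have h0 : monoMap a y₀ = 0 := by
      have : monoMap a y₀ ∈ ({0} : Set (Fin n → ℝ)) := hI ▸ Set.mem_image_of_mem _ hy₀
      exact this
    obtain ⟨j, -, hj⟩ := Finset.prod_eq_zero_iff.1 (congrFun h0 k)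
    obtain ⟨hj0, hjk⟩ := pow_eq_zero_iff'.1 hj
    exact ⟨j, Set.mem_toFinset.2 ((hy₀ j).1 hj0), hjk⟩
  simpa only [Set.mem_toFinset] using exists_pderiv1_strictTransform_ne_zero hUopen hU0 hfP.1
    hdet hLsub hg hfg hp hpL hnd hI' (y₀ := y₀) (by simpa only [Set.mem_toFinset] using hy₀) hgy₀

end KN
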